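/- arXiv:0905.1841 — 2 statements merged into one kernel-verified Lean document; each statement's English description precedes it below -/
import Mathlib

section
/- There exists an absolute constant δ > 0 such that for every totally real number field k of degree d ≥ 2 and every integer t with 1 ≤ t ≤ d, there exists a number field l which is a quadratic extension of k, has exactly t complex places and 2(d − t) real places, and satisfies |Δ_l| ≤ 2^{2d} · |Δ_k|^{2 + tδ}. -/
open NumberField

open NumberField.mixedEmbedding NumberField.InfinitePlace in
lemma aux_one (k : Type) [Field k] [NumberField k] [IsTotallyReal k]
    (hd : 2 ≤ Module.finrank ℚ k) (v : InfinitePlace k) :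
    ∃ a : 𝓞 k, (v.embedding (a : k)).re < 0 ∧
      (∀ w : InfinitePlace k, w ≠ v → 0 < (w.embedding (a : k)).re) ∧
      |((Algebra.norm ℚ (a : k) : ℚ) : ℝ)| ≤ |(discr k : ℝ)| ^ 3 := by
  classical
  have hD2 : (3 : ℝ) ≤ |(discr k : ℝ)| := by
    have := abs_discr_gt_two (K := k) (by omega)
    exact_mod_cast this
  set s : NNReal := NNReal.sqrt ‖discr k‖₊ with hs
  have hs2 : (s : ℝ) ^ 2 = |(discr k : ℝ)| := by
    rw [hs]
    simp [Int.norm_eq_abs]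
  have hs0 : 0 < s := by
    rw [pos_iff_ne_zero]
    intro h
    rw [h] at hs2
    norm_num at hs2
    rw [← hs2] at hD2
    norm_num at hD2
  have hM : minkowskiBound k ↑1 <
      MeasureTheory.volume (convexBodyLT k (fun w ↦ if w = v then 2 * s else 1)) := by
    rw [convexBodyLT_volume, minkowskiBound,
      volume_fundamentalDomain_fractionalIdealLatticeBasis, Units.val_one,
      FractionalIdeal.absNorm_one, Rat.cast_one,
      ENNReal.ofReal_one, one_mul, mixedEmbedding.finrank, volume_fundamentalDomain_latticeBasis,
      IsTotallyReal.finrank, convexBodyLTFactor, IsTotallyReal.nrComplexPlaces_eq_zero]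
    simp only [pow_zero, one_mul, mul_one, IsTotallyReal.mult_eq, pow_one,
      Finset.prod_ite_eq', Finset.mem_univ, if_true]
    rw [← hs]
    have : s * 2 ^ nrRealPlaces k < 2 ^ nrRealPlaces k * (2 * s) := by
      have : (0:NNReal) < s * 2 ^ nrRealPlaces k := by positivity
      calc s * 2 ^ nrRealPlaces k < s * 2 ^ nrRealPlaces k + s * 2 ^ nrRealPlaces k := by
            exact lt_add_of_pos_right _ this
        _ = _ := by ring
    exact_mod_cast this
  obtain ⟨b, hb0, hb⟩ := exists_ne_zero_mem_ringOfIntegers_lt k hM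
  have hre : ∀ (w : InfinitePlace k) (x : k), (w.embedding x) = ((w.embedding x).re : ℂ) := by
    intro w x
    rw [← embedding_of_isReal_apply (IsTotallyReal.isReal w), Complex.ofReal_re]
  have habs : ∀ (w : InfinitePlace k) (x : k), w x = |(w.embedding x).re| := by
    intro w x
    rw [← norm_embedding_eq, hre w x]; simp
  have hval : ∀ w : InfinitePlace k,
      (w.embedding ((1 - b ^ 2 : 𝓞 k) : k)).re = 1 - (w (b : k)) ^ 2 := by
    intro w
    rw [habs w, sq_abs]
    have : w.embedding ((1 - b ^ 2 : 𝓞 k) : k) = 1 - (w.embedding (b : k)) ^ 2 := by simp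
    rw [this, hre w b]
    norm_cast
  have hbw : ∀ w ≠ v, w (b : k) < 1 := fun w hw => by simpa [hw] using hb w
  have hbv : v (b : k) < 2 * s := by simpa using hb v
  have hbv1 : 1 < v (b : k) := by
    have h1 : ∏ w : InfinitePlace k, w (b : k) = |((Algebra.norm ℚ (b : k) : ℚ) : ℝ)| := by
      rw [← Rat.cast_abs, ← prod_eq_abs_norm (b : k)]; simp [IsTotallyReal.mult_eq]
    have h2 : (1 : ℝ) ≤ |((Algebra.norm ℚ (b : k) : ℚ) : ℝ)| := by
      rw [← Algebra.coe_norm_int]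
      have h3 : Algebra.norm ℤ b ≠ 0 := Algebra.norm_ne_zero_iff.2 hb0
      have := Int.one_le_abs h3
      exact_mod_cast this
    rw [← h1, ← Finset.mul_prod_erase _ _ (Finset.mem_univ v)] at h2
    have hpos : ∀ w : InfinitePlace k, 0 < w (b : k) := fun w => by
      rw [pos_iff]; exact RingOfIntegers.coe_ne_zero_iff.mpr hb0
    have h4 : ∏ w ∈ Finset.univ.erase v, w (b : k) < 1 := by
      have : (Finset.univ.erase v).Nonempty := by
        rw [← Finset.card_pos, Finset.card_erase_of_mem (Finset.mem_univ v), Finset.card_univ,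
          card_eq_nrRealPlaces_add_nrComplexPlaces, IsTotallyReal.nrComplexPlaces_eq_zero,
          ← IsTotallyReal.finrank]
        omega
      calc _ < ∏ w ∈ Finset.univ.erase v, (1 : ℝ) :=
            Finset.prod_lt_prod_of_nonempty (fun w _ => hpos w)
              (fun w hw => hbw w (Finset.ne_of_mem_erase hw)) this
        _ = 1 := by simp
    nlinarith [hpos v]
  refine ⟨1 - b ^ 2, ?_, ?_, ?_⟩
  · rw [hval]; nlinarith
  · intro w hw
    rw [hval]
    have := hbw w hw
    have h0 : 0 ≤ w (b : k) := apply_nonneg w _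
    nlinarith
  · have h1 := prod_eq_abs_norm ((1 - b ^ 2 : 𝓞 k) : k)
    have h1' : ∏ w : InfinitePlace k, w ((1 - b ^ 2 : 𝓞 k) : k) = 
      |((Algebra.norm ℚ ((1 - b ^ 2 : 𝓞 k) : k) : ℚ) : ℝ)| := by
      rw [← Rat.cast_abs, ← h1]; simp [IsTotallyReal.mult_eq]
    rw [← h1', ← Finset.mul_prod_erase _ _ (Finset.mem_univ v)]
    have h2 : ∏ w ∈ Finset.univ.erase v, w ((1 - b ^ 2 : 𝓞 k) : k) ≤ 1 := by
      apply Finset.prod_le_one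
      · intro w _; exact apply_nonneg w _
      · intro w hw
        have := hbw w (Finset.ne_of_mem_erase hw)
        have h0 : 0 ≤ w (b : k) := apply_nonneg w _
        rw [habs, hval, abs_le]
        constructor <;> nlinarith
    have h3 : v ((1 - b ^ 2 : 𝓞 k) : k) ≤ 4 * |(discr k : ℝ)| := by
      rw [habs, hval, abs_le, ← hs2]
      constructor <;> nlinarith
    have h0 : 0 ≤ v ((1 - b ^ 2 : 𝓞 k) : k) := apply_nonneg v _
    calc _ ≤ v ((1 - b ^ 2 : 𝓞 k) : k) * 1 := by gcongr
      _ ≤ 4 * |(discr k : ℝ)| := by linarith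
      _ ≤ _ := by nlinarith [sq_nonneg (|(discr k : ℝ)|)]

open NumberField.InfinitePlace in
lemma aux_prod (k : Type) [Field k] [NumberField k] [IsTotallyReal k]
    (hd : 2 ≤ Module.finrank ℚ k) (S : Finset (InfinitePlace k)) :
    ∃ a : 𝓞 k, (∀ w ∈ S, (w.embedding (a : k)).re < 0) ∧
      (∀ w : InfinitePlace k, w ∉ S → 0 < (w.embedding (a : k)).re) ∧
      |((Algebra.norm ℚ (a : k) : ℚ) : ℝ)| ≤ |(discr k : ℝ)| ^ (3 * S.card) := by
  classical
  have hre : ∀ (w : InfinitePlace k) (x : k), (w.embedding x).im = 0 := by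
    intro w x
    rw [← embedding_of_isReal_apply (IsTotallyReal.isReal w), Complex.ofReal_im]
  induction S using Finset.induction_on with
  | empty => exact ⟨1, by simp, by simp, by simp⟩
  | insert v S hv ih =>
    obtain ⟨a, h1, h2, h3⟩ := ih
    obtain ⟨b, g1, g2, g3⟩ := aux_one k hd v
    have hmul : ∀ w : InfinitePlace k, (w.embedding ((a * b : 𝓞 k) : k)).re =
        (w.embedding (a : k)).re * (w.embedding (b : k)).re := by
      intro w
      simp [Complex.mul_re, hre]
    refine ⟨a * b, ?_, ?_, ?_⟩
    · intro w hw
      rw [hmul]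
      rcases Finset.mem_insert.1 hw with rfl | hw
      · exact mul_neg_of_pos_of_neg (h2 _ hv) g1
      · exact mul_neg_of_neg_of_pos (h1 _ hw) (g2 _ (fun h => hv (h ▸ hw)))
    · intro w hw
      rw [hmul]
      rw [Finset.mem_insert, not_or] at hw
      exact mul_pos (h2 _ hw.2) (g2 _ hw.1)
    · rw [Finset.card_insert_of_notMem hv, mul_add, pow_add]
      simp only [map_mul, Rat.cast_mul, abs_mul]
      gcongr
open Polynomial in
lemma aux_discr (k l : Type) [Field k] [NumberField k] [Field l] [NumberField l] [Algebra k l]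
    (h2 : Module.finrank k l = 2) (a : 𝓞 k) (r : l) (hr : r ^ 2 = algebraMap k l a)
    (hmin : minpoly k r = X ^ 2 - C (a : k)) (htop : Algebra.adjoin k {r} = ⊤) (ha : a ≠ 0) :
    |(discr l : ℝ)| ≤ 2 ^ (2 * Module.finrank ℚ k) * |(discr k : ℝ)| ^ 2 *
      |((Algebra.norm ℚ (a : k) : ℚ) : ℝ)| := by
  have hint : IsIntegral ℤ r := by
    apply IsIntegral.of_pow (n := 2) (by norm_num)
    rw [hr]
    exact (RingOfIntegers.isIntegral_coe a).algebraMap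
  let x : 𝓞 l := ⟨r, hint⟩
  have hx : algebraMap (𝓞 l) l x = r := rfl
  have hx2 : x ^ 2 = algebraMap (𝓞 k) (𝓞 l) a := by
    apply RingOfIntegers.coe_injective
    rw [map_pow, hx, hr]; rfl
  have hminx : minpoly (𝓞 k) x = X ^ 2 - C a := by
    apply Polynomial.map_injective (algebraMap (𝓞 k) k) (RingOfIntegers.coe_injective)
    rw [← minpoly.isIntegrallyClosed_eq_field_fractions k l (Algebra.IsIntegral.isIntegral x)]
    rw [hx, hmin]
    simp
  have hmem := aeval_derivative_mem_differentIdeal (𝓞 k) k l x htop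
  rw [hminx] at hmem
  have hmem' : 2 * x ∈ differentIdeal (𝓞 k) (𝓞 l) := by
    have h : (1 + 1) * x ∈ differentIdeal (𝓞 k) (𝓞 l) := by simpa using hmem
    rwa [one_add_one_eq_two] at h
  have hD := natAbs_discr_eq_absNorm_differentIdeal_mul_natAbs_discr_pow k (𝓞 k) l (𝓞 l)
  have hx0 : 2 * x ≠ 0 := by
    intro h
    have : x = 0 := by simpa using h
    rw [this] at hx2
    apply ha
    apply FaithfulSMul.algebraMap_injective (𝓞 k) (𝓞 l)
    rw [← hx2]; simp
  have hle : Ideal.absNorm (differentIdeal (𝓞 k) (𝓞 l)) ≤ (Algebra.norm ℤ (2 * x)).natAbs := by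
    rw [← Ideal.absNorm_span_singleton]
    apply Nat.le_of_dvd
    · rw [Nat.pos_iff_ne_zero, Ideal.absNorm_span_singleton, Int.natAbs_ne_zero]
      exact Algebra.norm_ne_zero_iff.2 hx0
    · exact Ideal.absNorm_dvd_absNorm_of_le ((Ideal.span_singleton_le_iff_mem _).2 hmem')
  have hnorm : |((Algebra.norm ℤ (2 * x) : ℤ) : ℝ)| =
      2 ^ (2 * Module.finrank ℚ k) * |((Algebra.norm ℚ (a : k) : ℚ) : ℝ)| := by
    rw [← sq_eq_sq₀ (by positivity) (by positivity), sq_abs]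
    have e1 : ((Algebra.norm ℤ (2 * x) : ℤ) : ℚ) ^ 2 = 
        (2 ^ (2 * Module.finrank ℚ k) * Algebra.norm ℚ (a : k)) ^ 2 := by
      rw [Algebra.coe_norm_int, ← map_pow]
      have : (((2 * x : 𝓞 l) : l)) ^ 2 = algebraMap k l (4 * (a : k)) := by
        have e0 : ((2 * x : 𝓞 l) : l) = 2 * r := by
          change algebraMap (𝓞 l) l (2 * x) = 2 * r
          rw [map_mul, map_ofNat, hx]
        rw [e0, map_mul, ← hr, map_ofNat]
        ring
      rw [this, ← Algebra.norm_norm (S := k), Algebra.norm_algebraMap, h2, map_pow, map_mul]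
      have : Algebra.norm ℚ (4 : k) = 2 ^ (2 * Module.finrank ℚ k) := by
        have := Algebra.norm_algebraMap (S := k) (4 : ℚ)
        rw [pow_mul]
        norm_num at this ⊢
        exact this
      rw [this]
    have e2 := congrArg (fun q : ℚ => (q : ℝ)) e1
    push_cast at e2
    rw [e2, mul_pow, mul_pow, sq_abs]
  have hD' : |(discr l : ℝ)| = Ideal.absNorm (differentIdeal (𝓞 k) (𝓞 l)) * |(discr k : ℝ)| ^ 2 := by
    rw [h2] at hD
    have := congrArg (fun n : ℕ => (n : ℝ)) hD
    simpa [Nat.cast_natAbs] using this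
  have hle' : (Ideal.absNorm (differentIdeal (𝓞 k) (𝓞 l)) : ℝ) ≤
      |((Algebra.norm ℤ (2 * x) : ℤ) : ℝ)| := by
    have : ((Ideal.absNorm (differentIdeal (𝓞 k) (𝓞 l)) : ℕ) : ℝ) ≤
      ((Algebra.norm ℤ (2 * x)).natAbs : ℝ) := by exact_mod_cast hle
    simpa [Nat.cast_natAbs] using this
  rw [hnorm] at hle'
  rw [hD']
  calc _ ≤ (2 ^ (2 * Module.finrank ℚ k) * |((Algebra.norm ℚ (a : k) : ℚ) : ℝ)|) * |(discr k : ℝ)| ^ 2 := by gcongr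
    _ = _ := by ring

open NumberField.InfinitePlace in
lemma aux_places (k l : Type) [Field k] [NumberField k] [Field l] [NumberField l] [Algebra k l]
    [IsTotallyReal k] (a : k) (r : l) (hr : r ^ 2 = algebraMap k l a)
    (hext : ∀ f g : l →+* ℂ, f.comp (algebraMap k l) = g.comp (algebraMap k l) → f r = g r → f = g)
    (S : Finset (InfinitePlace k)) (h1 : ∀ w ∈ S, (w.embedding a).re < 0)
    (h2 : ∀ w : InfinitePlace k, w ∉ S → 0 < (w.embedding a).re) :
    nrComplexPlaces l = S.card := by
  classical
  have him : ∀ (w : InfinitePlace k) (x : k), (w.embedding x).im = 0 := by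
    intro w x
    rw [← embedding_of_isReal_apply (IsTotallyReal.isReal w), Complex.ofReal_im]
  have hcomp : ∀ w : InfinitePlace l, (w.comap (algebraMap k l)).embedding =
      w.embedding.comp (algebraMap k l) := fun w =>
    comap_embedding_of_isReal _ (IsTotallyReal.isReal _)
  have hsq : ∀ w : InfinitePlace l, (w.embedding r) ^ 2 =
      (((w.comap (algebraMap k l)).embedding a).re : ℂ) := by
    intro w
    rw [← map_pow, hr]
    apply Complex.ext
    · simp [hcomp]
    · rw [Complex.ofReal_im, ← him (w.comap (algebraMap k l)) a, hcomp]; rfl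
  have hre : ∀ w : InfinitePlace l, (w.embedding r).re ^ 2 - (w.embedding r).im ^ 2 = 
      ((w.comap (algebraMap k l)).embedding a).re := by
    intro w
    have := congrArg Complex.re (hsq w)
    rw [Complex.ofReal_re, sq, Complex.mul_re] at this
    rw [← this]; ring
  have hri : ∀ w : InfinitePlace l, (w.embedding r).re * (w.embedding r).im = 0 := by
    intro w
    have := congrArg Complex.im (hsq w)
    rw [Complex.ofReal_im, sq, Complex.mul_im] at this
    linarith
  have hconjk : ∀ w : InfinitePlace l, (ComplexEmbedding.conjugate w.embedding).comp
      (algebraMap k l) = w.embedding.comp (algebraMap k l) := by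
    intro w
    rw [← hcomp]
    ext x
    have := him (w.comap (algebraMap k l)) x
    rw [RingHom.comp_apply, ComplexEmbedding.conjugate_coe_eq]
    have e : w.embedding (algebraMap k l x) = (w.comap (algebraMap k l)).embedding x := by
      rw [hcomp]; rfl
    rw [e]
    exact Complex.conj_eq_iff_im.2 this
  have hiff : ∀ w : InfinitePlace l, IsComplex w ↔ w.comap (algebraMap k l) ∈ S := by
    intro w
    constructor
    · intro hw
      by_contra hS
      have hp := h2 _ hS
      rw [isComplex_iff] at hw
      apply hw
      rw [ComplexEmbedding.isReal_iff]
      apply hext _ _ (hconjk w)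
      rw [ComplexEmbedding.conjugate_coe_eq]
      apply Complex.conj_eq_iff_im.2
      rw [← hre] at hp
      rcases mul_eq_zero.1 (hri w) with h | h
      · rw [h] at hp; nlinarith [sq_nonneg (w.embedding r).im]
      · exact h
    · intro hS
      have hp := h1 _ hS
      rw [isComplex_iff]
      intro hw
      rw [ComplexEmbedding.isReal_iff] at hw
      have := congrArg (fun f => f r) hw
      simp only [ComplexEmbedding.conjugate_coe_eq] at this
      have := Complex.conj_eq_iff_im.1 this
      rw [← hre, this] at hp
      nlinarith [sq_nonneg (w.embedding r).re]
  rw [nrComplexPlaces, ← Fintype.card_coe]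
  apply Fintype.card_of_bijective
    (f := fun w : {w : InfinitePlace l // IsComplex w} =>
      (⟨w.1.comap (algebraMap k l), (hiff w.1).1 w.2⟩ : {v // v ∈ S}))
  constructor
  · rintro ⟨w, hw⟩ ⟨w', hw'⟩ h
    simp only [Subtype.mk.injEq] at h ⊢
    have hc : w.embedding.comp (algebraMap k l) = w'.embedding.comp (algebraMap k l) := by
      rw [← hcomp, ← hcomp, h]
    have hs : (w.embedding r) ^ 2 = (w'.embedding r) ^ 2 := by
      rw [hsq, hsq, h]
    rcases sq_eq_sq_iff_eq_or_eq_neg.1 hs with e | e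
    · rw [← mk_embedding w, ← mk_embedding w', hext _ _ hc e]
    · rw [← mk_embedding w, ← mk_embedding w', mk_eq_iff]
      right
      apply hext _ _ ((hconjk w).trans hc)
      rw [ComplexEmbedding.conjugate_coe_eq]
      have hp := h1 _ ((hiff w).1 hw)
      rw [← hre] at hp
      have h0 : (w.embedding r).re = 0 := by
        rcases mul_eq_zero.1 (hri w) with h | h
        · exact h
        · rw [h] at hp; nlinarith [sq_nonneg (w.embedding r).re]
      have e' : w'.embedding r = - w.embedding r := by rw [e, neg_neg]
      rw [e']
      apply Complex.ext <;> simp [h0]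
  · rintro ⟨v, hv⟩
    obtain ⟨w, rfl⟩ := comap_surjective (K := l) v
    exact ⟨⟨w, (hiff w).2 hv⟩, rfl⟩

open NumberField.InfinitePlace Polynomial in
theorem stmt_9 :
    ∃ δ : ℝ, 0 < δ ∧
      ∀ (k : Type) [Field k] [NumberField k],
        (∀ φ : k →+* ℂ, ∀ x : k, (φ x).im = 0) →
        2 ≤ Module.finrank ℚ k →
        ∀ t : ℕ, 1 ≤ t → t ≤ Module.finrank ℚ k →
          ∃ (l : Type) (_ : Field l) (_ : NumberField l) (_ : Algebra k l),
            Module.finrank k l = 2 ∧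
            InfinitePlace.nrComplexPlaces l = t ∧
            InfinitePlace.nrRealPlaces l = 2 * (Module.finrank ℚ k - t) ∧
            |(NumberField.discr l : ℝ)| ≤
              2 ^ (2 * Module.finrank ℚ k) *
                |(NumberField.discr k : ℝ)| ^ (2 + (t : ℝ) * δ) := by
  classical
  refine ⟨3, by norm_num, ?_⟩
  intro k _ _ htr hd t ht1 htd
  have : IsTotallyReal k := ⟨fun w => by
    rw [isReal_iff, ComplexEmbedding.isReal_iff]
    ext x
    rw [ComplexEmbedding.conjugate_coe_eq]
    exact Complex.conj_eq_iff_im.2 (htr _ x)⟩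
  have hcard : Fintype.card (InfinitePlace k) = Module.finrank ℚ k := by
    rw [card_eq_nrRealPlaces_add_nrComplexPlaces, IsTotallyReal.nrComplexPlaces_eq_zero,
          ← IsTotallyReal.finrank, add_zero]
  obtain ⟨S, -, hS⟩ := Finset.exists_subset_card_eq
    (s := (Finset.univ : Finset (InfinitePlace k))) (n := t)
    (by rw [Finset.card_univ, hcard]; exact htd)
  obtain ⟨a, h1, h2, h3⟩ := aux_prod k hd S
  obtain ⟨v, hv⟩ : S.Nonempty := by rw [← Finset.card_pos]; omega
  have ha : a ≠ 0 := by
    rintro rfl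
    simpa using h1 v hv
  have hirr : Irreducible (X ^ 2 - C (a : k) : k[X]) := by
    apply X_pow_sub_C_irreducible_of_prime Nat.prime_two
    intro b hb
    have h := h1 v hv
    rw [← hb, map_pow, sq, Complex.mul_re, htr] at h
    nlinarith [sq_nonneg (v.embedding b).re]
  have hmonic : (X ^ 2 - C (a : k) : k[X]).Monic := monic_X_pow_sub_C _ (by norm_num)
  have : Fact (Irreducible (X ^ 2 - C (a : k) : k[X])) := ⟨hirr⟩
  let l := AdjoinRoot (X ^ 2 - C (a : k) : k[X])
  let r : l := AdjoinRoot.root _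
  have hfin : Module.finrank k l = 2 := by
    rw [PowerBasis.finrank (AdjoinRoot.powerBasis hirr.ne_zero), AdjoinRoot.powerBasis_dim,
      natDegree_X_pow_sub_C]
  have : FiniteDimensional k l := Module.finite_of_finrank_pos (by omega)
  have : CharZero l := charZero_of_injective_algebraMap (algebraMap k l).injective
  have : FiniteDimensional ℚ l := Module.Finite.trans k l
  have hnf : NumberField l := ⟨⟩
  have hr : r ^ 2 = algebraMap k l a := by
    have := AdjoinRoot.eval₂_root (X ^ 2 - C (a : k) : k[X])
    simp only [eval₂_sub, eval₂_pow, eval₂_X, eval₂_C] at this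
    exact sub_eq_zero.1 this
  have hmin : minpoly k r = X ^ 2 - C (a : k) := by
    rw [AdjoinRoot.minpoly_root hirr.ne_zero, hmonic.leadingCoeff]; simp
  have htop : Algebra.adjoin k {r} = ⊤ := AdjoinRoot.adjoinRoot_eq_top
  have hcx : nrComplexPlaces l = t := by
    rw [← hS]
    apply aux_places k l (a : k) r hr _ S h1 h2
    intro f g hfg hfr
    exact AdjoinRoot.ringHom_ext hfg hfr
  refine ⟨l, inferInstance, hnf, inferInstance, hfin, hcx, ?_, ?_⟩
  · have h := card_add_two_mul_card_eq_rank l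
    rw [← Module.finrank_mul_finrank ℚ k l, hfin, hcx] at h
    omega
  · refine (aux_discr k l hfin a r hr hmin htop ha).trans ?_
    rw [hS] at h3
    have : |(discr k : ℝ)| ^ (2 + (t : ℝ) * 3) = |(discr k : ℝ)| ^ 2 * |(discr k : ℝ)| ^ (3 * t) := by
      rw [← pow_add, ← Real.rpow_natCast]
      congr 1
      push_cast; ring
    rw [this, ← mul_assoc]
    gcongr
end

section
/- Let p be a prime and s, f ≥ 1 integers. Then every subgroup of the general linear group GL_s(𝔽_{p^f}) over the finite field with p^f elements can be generated by fewer than 2s²f elements. -/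
def GenLE (G : Type) [Group G] (n : ℕ) : Prop :=
  ∃ S : Finset G, S.card ≤ n ∧ Subgroup.closure (S : Set G) = ⊤

theorem GenLE.mono {G : Type} [Group G] {n m : ℕ} (h : GenLE G n) (hnm : n ≤ m) : GenLE G m := by
  obtain ⟨S, h1, h2⟩ := h
  exact ⟨S, h1.trans hnm, h2⟩

theorem GenLE.map {G Q : Type} [Group G] [Group Q] (f : G →* Q) (hf : Function.Surjective f)
    {n : ℕ} (h : GenLE G n) : GenLE Q n := by
  classical
  obtain ⟨S, h1, h2⟩ := h
  refine ⟨S.image f, Finset.card_image_le.trans h1, ?_⟩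
  rw [Finset.coe_image, ← MonoidHom.map_closure, h2, ← MonoidHom.range_eq_map,
    MonoidHom.range_eq_top.2 hf]

theorem GenLE.congr {G Q : Type} [Group G] [Group Q] (f : G ≃* Q)
    {n : ℕ} (h : GenLE G n) : GenLE Q n := GenLE.map f.toMonoidHom f.surjective h

/-- generation of a subgroup, in ambient terms -/
theorem genLE_subgroup_iff {G : Type} [Group G] (H : Subgroup G) (n : ℕ) :
    GenLE H n ↔ ∃ S : Finset G, S.card ≤ n ∧ Subgroup.closure (S : Set G) = H := by
  classical
  constructor
  · rintro ⟨S, h1, h2⟩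
    refine ⟨S.image H.subtype, Finset.card_image_le.trans h1, ?_⟩
    rw [Finset.coe_image, ← MonoidHom.map_closure, h2, ← MonoidHom.range_eq_map,
      Subgroup.range_subtype]
  · rintro ⟨S, h1, h2⟩
    have hS : ∀ x ∈ S, x ∈ H := fun x hx => h2 ▸ Subgroup.subset_closure hx
    refine ⟨S.subtype (· ∈ H), (Finset.card_subtype _ _).le.trans
      ((Finset.card_filter_le _ _).trans h1), ?_⟩
    apply Subgroup.map_injective H.subtype_injective
    rw [MonoidHom.map_closure, ← MonoidHom.range_eq_map, Subgroup.range_subtype]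
    rw [← h2]
    congr 1
    ext x
    simp
    grind

theorem GenLE.sup {G : Type} [Group G] {H K : Subgroup G} {n m : ℕ} (h : GenLE H n)
    (k : GenLE K m) : GenLE (H ⊔ K : Subgroup G) (n + m) := by
  classical
  rw [genLE_subgroup_iff] at *
  obtain ⟨S, h1, h2⟩ := h
  obtain ⟨T, h3, h4⟩ := k
  refine ⟨S ∪ T, (Finset.card_union_le _ _).trans (by omega), ?_⟩
  rw [Finset.coe_union, Subgroup.closure_union, h2, h4]

theorem genLE_top {G : Type} [Group G] {n : ℕ} (h : GenLE (⊤ : Subgroup G) n) : GenLE G n :=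
  h.congr Subgroup.topEquiv

theorem GenLE.toTop {G : Type} [Group G] {n : ℕ} (h : GenLE G n) : GenLE (⊤ : Subgroup G) n :=
  h.congr Subgroup.topEquiv.symm

theorem genLE_cyclic {G : Type} [Group G] [IsCyclic G] : GenLE G 1 := by
  obtain ⟨g, hg⟩ := IsCyclic.exists_generator (α := G)
  refine ⟨{g}, by simp, ?_⟩
  rw [Finset.coe_singleton, ← Subgroup.zpowers_eq_closure]
  exact (Subgroup.eq_top_iff' _).2 hg

theorem genLE_of_subsingleton {G : Type} [Group G] [Subsingleton G] : GenLE G 0 :=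
  ⟨∅, by simp, Subsingleton.elim _ _⟩

/-- A subgroup `L` (generated by `n`) such that `f` maps `L` onto the range ... -/
theorem GenLE.extend {G Q : Type} [Group G] [Group Q] (f : G →* Q)
    {n m : ℕ} (h : GenLE f.ker n) (k : GenLE f.range m) : GenLE G (n + m) := by
  classical
  obtain ⟨T, h3, h4⟩ := k
  choose g hg using f.rangeRestrict_surjective
  set L := Subgroup.closure ((T.image g : Finset G) : Set G) with hL
  have hLG : GenLE L m := (genLE_subgroup_iff L m).2 ⟨T.image g, Finset.card_image_le.trans h3, rfl⟩
  have hmap : L.map f.rangeRestrict = ⊤ := by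
    rw [hL, MonoidHom.map_closure, ← h4]
    congr 1
    ext x
    rw [Set.mem_image]
    constructor
    · rintro ⟨y, hy, rfl⟩
      obtain ⟨z, hz, rfl⟩ := Finset.mem_image.1 (Finset.mem_coe.1 hy)
      rw [hg]; exact hz
    · intro hx
      exact ⟨g x, Finset.mem_coe.2 (Finset.mem_image_of_mem g hx), hg x⟩
  have : f.ker ⊔ L = ⊤ := by
    rw [eq_top_iff]
    intro x _
    have : f.rangeRestrict x ∈ L.map f.rangeRestrict := hmap ▸ Subgroup.mem_top _
    obtain ⟨y, hy, hyx⟩ := this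
    have hyx' : f y = f x := congrArg Subtype.val hyx
    have : x = (x * y⁻¹) * y := by group
    rw [this]
    apply Subgroup.mul_mem_sup _ hy
    rw [MonoidHom.mem_ker, map_mul, map_inv, hyx', mul_inv_cancel]
  exact genLE_top (this ▸ h.sup hLG)

/-- If `L → G/N` is surjective -/
theorem GenLE.extend' {G : Type} [Group G] (N L : Subgroup G) (hNL : N ⊔ L = ⊤)
    {n m : ℕ} (h : GenLE N n) (k : GenLE L m) : GenLE G (n + m) :=
  genLE_top (hNL ▸ h.sup k)

theorem GenLE.finset_sup {G ι : Type} [Group G] (s : Finset ι) (H : ι → Subgroup G)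
    (n : ι → ℕ) (h : ∀ i ∈ s, GenLE (H i) (n i)) :
    GenLE (s.sup H : Subgroup G) (∑ i ∈ s, n i) := by
  classical
  induction s using Finset.induction_on with
  | empty => 
    rw [Finset.sup_empty, Finset.sum_empty]
    exact (genLE_of_subsingleton (G := (⊥ : Subgroup G)))
  | insert a s ha ih =>
    rw [Finset.sup_insert, Finset.sum_insert ha]
    exact (h a (Finset.mem_insert_self _ _)).sup
      (ih fun i hi => h i (Finset.mem_insert_of_mem hi))

/-- chain lemma -/
theorem chain_lemma {G : Type} [Group G] [Finite G] (p : ℕ) [hp : Fact p.Prime] (N : Subgroup G)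
    (hN : ∃ X : Set G, (∀ x ∈ X, ∃ k, x ^ p ^ k = 1) ∧ Subgroup.closure X = N) :
    ∃ n, p ^ n ≤ Nat.card N ∧ GenLE N n := by
  classical
  obtain ⟨X, hX, rfl⟩ := hN
  -- maximal counterexample
  have key : ∀ j : ℕ, ∀ K : Subgroup G, K ≤ Subgroup.closure X → 
      Nat.card (Subgroup.closure X) - Nat.card K = j →
      ∀ n, p ^ n ≤ Nat.card K → GenLE K n → 
      ∃ n, p ^ n ≤ Nat.card (Subgroup.closure X) ∧ GenLE (Subgroup.closure X) n := by
    intro j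
    induction j using Nat.strong_induction_on with
    | _ j ih =>
    intro K hK hj n hn hg
    by_cases hKX : X ⊆ K
    · have : K = Subgroup.closure X := le_antisymm hK ((Subgroup.closure_le _).2 hKX)
      subst this
      exact ⟨n, hn, hg⟩
    obtain ⟨x, hxX, hxK⟩ := Set.not_subset.1 hKX
    obtain ⟨k, hk⟩ := hX x hxX
    have hex : ∃ k, x ^ p ^ k ∈ K := ⟨k, by rw [hk]; exact K.one_mem⟩
    set k0 := Nat.find hex with hk0
    have h0 : x ^ p ^ k0 ∈ K := Nat.find_spec hex
    have hk0pos : k0 ≠ 0 := by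
      intro h
      rw [h] at h0
      simp at h0
      exact hxK h0
    obtain ⟨k1, hk1⟩ := Nat.exists_eq_succ_of_ne_zero hk0pos
    set y := x ^ p ^ k1 with hy
    have hyK : y ∉ K := Nat.find_min hex (by omega)
    have hypK : y ^ p ∈ K := by
      rw [hy, ← pow_mul, ← pow_succ]; rw [hk1] at h0; exact h0
    have hyX : y ∈ Subgroup.closure X := Subgroup.pow_mem _ (Subgroup.subset_closure hxX) _
    set K' := K ⊔ Subgroup.zpowers y with hK'
    have hyK' : y ∈ K' := (le_sup_right : Subgroup.zpowers y ≤ K') (Subgroup.mem_zpowers y)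
    have hcard : p * Nat.card K ≤ Nat.card K' := by
      have hinj : Function.Injective (fun a : Fin p × K =>
          (⟨y ^ (a.1 : ℕ) * a.2, K'.mul_mem (K'.pow_mem hyK' _)
            ((le_sup_left : K ≤ K') a.2.2)⟩ : K')) := by
        have aux : ∀ i j : ℕ, i < j → j < p → ∀ a b : K, y ^ i * (a : G) ≠ y ^ j * b := by
          intro i j hij hjp a b h
          have h1 : y ^ (j - i) ∈ K := by
            have : y ^ (j - i) = a * (b : G)⁻¹ := by
              have h2 : y ^ j = y ^ i * y ^ (j - i) := by rw [← pow_add]; congr 1; omega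
              rw [h2, mul_assoc] at h
              have := mul_left_cancel h
              rw [this]; group
            rw [this]
            exact K.mul_mem a.2 (K.inv_mem b.2)
          have hco : Nat.Coprime (j - i) p := by
            rw [Nat.coprime_comm]
            exact Nat.coprime_of_lt_prime (by omega) (by omega) hp.out
          apply hyK
          have hb := Nat.gcd_eq_gcd_ab (j - i) p
          rw [hco] at hb
          have : y = (y ^ (j - i)) ^ (Nat.gcdA (j - i) p) * (y ^ p) ^ (Nat.gcdB (j - i) p) := by
            rw [← zpow_natCast, ← zpow_natCast, ← zpow_mul, ← zpow_mul, ← zpow_add, ← hb]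
            simp
          rw [this]
          exact K.mul_mem (K.zpow_mem h1 _) (K.zpow_mem hypK _)
        rintro ⟨i, a⟩ ⟨j, b⟩ h
        have h : y ^ (i : ℕ) * (a : G) = y ^ (j : ℕ) * b := congrArg Subtype.val h
        rcases lt_trichotomy (i : ℕ) j with hij | hij | hij
        · exact absurd h (aux _ _ hij j.2 _ _)
        · rw [hij] at h
          have h1 := mul_left_cancel h
          ext
          · exact hij
          · exact h1
        · exact absurd h.symm (aux _ _ hij i.2 _ _)
      have := Nat.card_le_card_of_injective _ hinj
      simpa [Nat.card_prod] using this
    have hK'X : K' ≤ Subgroup.closure X := sup_le hK (by rwa [Subgroup.zpowers_le])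
    have hKpos : 0 < Nat.card K := Nat.card_pos
    have hle : Nat.card K' ≤ Nat.card (Subgroup.closure X) := 
      Nat.card_le_card_of_injective _ (Subgroup.inclusion_injective hK'X)
    have h2p := hp.out.two_le
    refine ih _ ?_ K' hK'X rfl (n + 1) ?_ (hg.sup genLE_cyclic)
    · have : Nat.card K < Nat.card K' := by nlinarith
      omega
    · rw [pow_succ]; nlinarith
  exact key _ ⊥ bot_le rfl 0 (by simp) genLE_of_subsingleton


/-- `G` has a faithful representation of dimension `n` over `K`. -/
def Emb (K : Type) [Field K] (n : ℕ) (G : Type) [Group G] : Prop :=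
  ∃ (V : Type) (_ : AddCommGroup V) (_ : Module K V) (_ : FiniteDimensional K V)
    (ρ : Representation K G V), Module.finrank K V = n ∧ Function.Injective ρ

def Split (K : Type) [Field K] (n : ℕ) (G : Type) [Group G] : Prop :=
  ∃ a b : ℕ, 1 ≤ a ∧ 1 ≤ b ∧ a + b = n ∧ ∃ (Q₁ Q₂ : Type) (_ : Group Q₁) (_ : Group Q₂)
    (f₁ : G →* Q₁) (f₂ : G →* Q₂), Function.Surjective f₁ ∧ Function.Surjective f₂ ∧
    Emb K a Q₁ ∧ Emb K b Q₂ ∧ ∀ g, f₁ g = 1 → f₂ g = 1 → g = 1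

def IrrEmb (K : Type) [Field K] (n : ℕ) (G : Type) [Group G] : Prop :=
  ∃ (V : Type) (_ : AddCommGroup V) (_ : Module K V) (_ : FiniteDimensional K V)
    (ρ : Representation K G V), Module.finrank K V = n ∧ Function.Injective ρ ∧ ρ.IsIrreducible

section
variable {K : Type} [Field K] {n : ℕ} {G : Type} [Group G]

theorem Emb.comap {H : Type} [Group H] (f : H →* G) (hf : Function.Injective f)
    (h : Emb K n G) : Emb K n H := by
  obtain ⟨V, i1, i2, i3, ρ, h1, h2⟩ := h
  exact ⟨V, i1, i2, i3, ρ.comp f, h1, h2.comp hf⟩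

theorem Emb.subgroup (H : Subgroup G) (h : Emb K n G) : Emb K n H :=
  h.comap H.subtype H.subtype_injective

theorem Emb.range {V : Type} [AddCommGroup V] [Module K V] [FiniteDimensional K V]
    (ρ : Representation K G V) : Emb K (Module.finrank K V) (ρ.asGroupHom.range) :=
  ⟨V, inferInstance, inferInstance, inferInstance,
    (Units.coeHom _).comp (ρ.asGroupHom.range.subtype), rfl,
    Units.val_injective.comp Subtype.val_injective⟩

theorem exists_compl_subrep [Finite G] [NeZero (Nat.card G : K)]
    {V : Type} [AddCommGroup V] [Module K V]
    (ρ : Representation K G V) (σ : Subrepresentation ρ) :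
    ∃ τ : Subrepresentation ρ, IsCompl σ.toSubmodule τ.toSubmodule := by
  obtain ⟨τ, hτ⟩ := exists_isCompl σ
  refine ⟨τ, ?_⟩
  rw [isCompl_iff, disjoint_iff, codisjoint_iff] at *
  refine ⟨?_, ?_⟩
  · rw [← Subrepresentation.toSubmodule_inf, hτ.1]; rfl
  · rw [← Subrepresentation.toSubmodule_sup, hτ.2]; rfl

theorem split_of_invariant [Finite G] [NeZero (Nat.card G : K)]
    {V : Type} [AddCommGroup V] [Module K V] [FiniteDimensional K V]
    (ρ : Representation K G V) (hρ : Function.Injective ρ) (W : Submodule K V)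
    (hW : ∀ g, ∀ v ∈ W, ρ g v ∈ W) (h0 : W ≠ ⊥) (h1 : W ≠ ⊤) :
    Split K (Module.finrank K V) G := by
  let σ : Subrepresentation ρ := ⟨W, fun g v hv => hW g v hv⟩
  obtain ⟨τ, hτ⟩ := exists_compl_subrep ρ σ
  have hσ : σ.toSubmodule = W := rfl
  have hfr := Submodule.finrank_add_eq_of_isCompl hτ
  have hlt := Submodule.finrank_lt h1
  refine ⟨Module.finrank K σ.toSubmodule, Module.finrank K τ.toSubmodule, ?_, ?_, hfr,
    _, _, _, _, (σ.toRepresentation.asGroupHom).rangeRestrict,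
    (τ.toRepresentation.asGroupHom).rangeRestrict, MonoidHom.rangeRestrict_surjective _,
    MonoidHom.rangeRestrict_surjective _,
    Emb.range σ.toRepresentation, Emb.range τ.toRepresentation, ?_⟩
  · exact Submodule.one_le_finrank_iff.2 h0
  · rw [hσ] at hfr; omega
  · intro g hg1 hg2
    apply hρ
    rw [map_one]
    have e1 : σ.toRepresentation g = 1 := by
      have := congrArg Subtype.val hg1
      exact congrArg Units.val this
    have e2 : τ.toRepresentation g = 1 := by
      have := congrArg Subtype.val hg2
      exact congrArg Units.val this
    ext v
    have hv : v ∈ σ.toSubmodule ⊔ τ.toSubmodule := by rw [hτ.sup_eq_top]; trivial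
    obtain ⟨x, hx, y, hy, rfl⟩ := Submodule.mem_sup.1 hv
    have a1 : ρ g x = x := congrArg Subtype.val (LinearMap.congr_fun e1 ⟨x, hx⟩)
    have a2 : ρ g y = y := congrArg Subtype.val (LinearMap.congr_fun e2 ⟨y, hy⟩)
    rw [map_add, a1, a2]; rfl

theorem irr_or_split [Finite G] [NeZero (Nat.card G : K)] (hn : 1 ≤ n) (h : Emb K n G) :
    IrrEmb K n G ∨ Split K n G := by
  obtain ⟨V, i1, i2, i3, ρ, rfl, h2⟩ := h
  by_cases hir : ρ.IsIrreducible
  · exact Or.inl ⟨V, i1, i2, i3, ρ, rfl, h2, hir⟩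
  right
  have hnt : Nontrivial V := Module.finrank_pos_iff.1 hn
  have hnt' : Nontrivial (Subrepresentation ρ) := by
    refine ⟨⊥, ⊤, fun h => ?_⟩
    have : (⊥ : Submodule K V) = ⊤ := congrArg Subrepresentation.toSubmodule h
    exact bot_ne_top this
  have : ∃ σ : Subrepresentation ρ, σ ≠ ⊥ ∧ σ ≠ ⊤ := by
    by_contra hcon
    push Not at hcon
    exact hir ⟨fun a => or_iff_not_imp_left.2 (hcon a)⟩
  obtain ⟨σ, hb, ht⟩ := this
  refine split_of_invariant ρ h2 σ.toSubmodule (fun g v hv => σ.apply_mem_toSubmodule g hv) ?_ ?_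
  · intro h; exact hb (Subrepresentation.toSubmodule_injective h)
  · intro h; exact ht (Subrepresentation.toSubmodule_injective h)

theorem neZero_card_of_surj {Q : Type} [Group Q] (f : G →* Q) [Finite G]
    (hf : Function.Surjective f) [h : NeZero (Nat.card G : K)] : NeZero (Nat.card Q : K) := by
  constructor
  intro h0
  obtain ⟨c, hc⟩ := Subgroup.card_dvd_of_surjective f hf
  apply h.out
  rw [hc, Nat.cast_mul, h0, zero_mul]

theorem neZero_card_of_inj {Q : Type} [Group Q] (f : Q →* G) [Finite G]
    (hf : Function.Injective f) [h : NeZero (Nat.card G : K)] : NeZero (Nat.card Q : K) := by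
  constructor
  intro h0
  obtain ⟨c, hc⟩ := Subgroup.card_dvd_of_injective f hf
  apply h.out
  rw [hc, Nat.cast_mul, h0, zero_mul]

/-- generation bound in the split case -/
theorem Split.genLE {u v : ℕ}  {Q₁ Q₂ : Type} [Group Q₁] [Group Q₂]
    (f₁ : G →* Q₁) (hs : Function.Surjective f₁) (hu : GenLE f₁.ker u) (hv : GenLE Q₁ v) :
    GenLE G (u + v) := by
  refine GenLE.extend f₁ hu ?_
  rw [MonoidHom.range_eq_top.2 hs]
  exact hv.toTop

theorem emb_one_cyclic [Finite G] (h : Emb K 1 G) : IsCyclic G := by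
  obtain ⟨V, i1, i2, i3, ρ, h1, h2⟩ := h
  refine isCyclic_of_injective_ringHom ((LinearMap.det : (V →ₗ[K] V) →* K).comp ρ) ?_
  intro g g' h
  apply h2
  have key : ∀ x : V →ₗ[K] V, x = (LinearMap.det x) • LinearMap.id := by
    intro x
    have hnt : Nontrivial V := (Module.finrank_pos_iff (R := K)).1 (by omega)
    obtain ⟨v, hv⟩ := exists_ne (0 : V)
    have h3 := (finrank_eq_one_iff_of_nonzero' v hv).1 h1
    obtain ⟨c, hc⟩ := h3 (x v)
    have hx : x = c • LinearMap.id := by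
      ext w
      obtain ⟨d, rfl⟩ := h3 w
      rw [map_smul, ← hc]
      simp
    have hd : LinearMap.det x = c := by
      rw [hx, LinearMap.det_smul, h1]; simp
    rw [hd]; exact hx
  rw [key (ρ g), key (ρ g')]
  exact congrArg (· • LinearMap.id) h
end


section
variable {K : Type} [Field K] {n : ℕ} {G : Type} [Group G]

theorem Split.ker_emb {b : ℕ} {Q₁ Q₂ : Type} [Group Q₁] [Group Q₂]
    (f₁ : G →* Q₁) (f₂ : G →* Q₂) (h2 : Emb K b Q₂) (hi : ∀ g, f₁ g = 1 → f₂ g = 1 → g = 1) :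
    Emb K b f₁.ker := by
  refine h2.comap (f₂.comp f₁.ker.subtype) ?_
  rw [injective_iff_map_eq_one]
  rintro ⟨g, hg⟩ h
  ext
  exact hi g hg h

theorem schur_central [IsAlgClosed K] {V : Type} [AddCommGroup V] [Module K V]
    [FiniteDimensional K V] (ρ : Representation K G V) [ρ.IsIrreducible]
    (a : G) (ha : ∀ g, g * a = a * g) : ∃ c : K, ρ a = c • 1 := by
  let F : Representation.IntertwiningMap ρ ρ := ⟨ρ a, fun g => by
    have := congrArg ρ (ha g)
    rw [map_mul, map_mul] at this
    exact this.symm⟩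
  obtain ⟨c, hc⟩ := (Representation.IsIrreducible.algebraMap_intertwiningMap_bijective_of_isAlgClosed (ρ := ρ)).2 F
  refine ⟨c, ?_⟩
  ext v
  have := congrArg (fun f : Representation.IntertwiningMap ρ ρ => f v) hc
  simp [F] at this
  exact this.symm

theorem central_of_scalar {V : Type} [AddCommGroup V] [Module K V]
    (ρ : Representation K G V) (hρ : Function.Injective ρ)
    (a : G) (c : K) (hc : ρ a = c • 1) (g : G) : g * a = a * g := by
  apply hρ
  rw [map_mul, map_mul, hc]
  simp

theorem center_cyclic [IsAlgClosed K] [Finite G] {V : Type} [AddCommGroup V] [Module K V]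
    [FiniteDimensional K V] (ρ : Representation K G V) [ρ.IsIrreducible]
    (hρ : Function.Injective ρ) (hn : 1 ≤ Module.finrank K V) :
    IsCyclic (Subgroup.center G) := by
  have hs : ∀ z : Subgroup.center G, ∃ c : K, ρ z = c • 1 := fun z =>
    schur_central ρ z (Subgroup.mem_center_iff.1 z.2)
  choose c hc using hs
  have hnt : Nontrivial V := (Module.finrank_pos_iff (R := K)).1 (by omega)
  have hinj : ∀ x y : K, x • (1 : V →ₗ[K] V) = y • 1 → x = y := by
    intro x y h
    obtain ⟨v, hv⟩ := exists_ne (0 : V)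
    have := LinearMap.congr_fun h v
    simpa using smul_left_injective K hv this
  refine isCyclic_of_injective_ringHom (R := K) (⟨⟨c, ?_⟩, ?_⟩ : Subgroup.center G →* K) ?_
  · apply hinj; rw [← hc]; simp
  · intro x y
    apply hinj
    change c (x * y) • (1 : V →ₗ[K] V) = (c x * c y) • 1
    rw [← hc, mul_smul, ← hc y]
    simp only [Subgroup.coe_mul, map_mul]
    rw [hc x]; simp
  · intro x y h
    have h : c x = c y := h
    ext
    apply hρ
    rw [hc, hc, h]

/-- commutator with an element of the second centre -/
theorem exists_second_center {l : ℕ} [Fact l.Prime] [Finite G] (hG : IsPGroup l G)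
    (hna : ¬ ∀ a b : G, a * b = b * a) :
    ∃ a : G, (¬ ∀ g, g * a = a * g) ∧ ∃ z : G →* Subgroup.center G,
      ∀ g, g * a * g⁻¹ = z g * a := by
  have hnt : Nontrivial (G ⧸ Subgroup.center G) := by
    by_contra h
    rw [not_nontrivial_iff_subsingleton] at h
    have := (QuotientGroup.subsingleton_iff (N := Subgroup.center G)).1 h
    apply hna
    intro a b
    have hb : b ∈ Subgroup.center G := this ▸ Subgroup.mem_top b
    exact Subgroup.mem_center_iff.1 hb a
  have hc := (hG.to_quotient (Subgroup.center G)).center_nontrivial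
  obtain ⟨⟨q, hq⟩, hq1⟩ := exists_ne (1 : Subgroup.center (G ⧸ Subgroup.center G))
  obtain ⟨a, rfl⟩ := QuotientGroup.mk_surjective q
  have hza : ∀ g, g * a * g⁻¹ * a⁻¹ ∈ Subgroup.center G := by
    intro g
    rw [← QuotientGroup.eq_one_iff]
    have := Subgroup.mem_center_iff.1 hq (g : G ⧸ Subgroup.center G)
    simp only [QuotientGroup.mk_mul, QuotientGroup.mk_inv]
    rw [this]; group
  refine ⟨a, ?_, ⟨⟨fun g => ⟨g * a * g⁻¹ * a⁻¹, hza g⟩, ?_⟩, ?_⟩, ?_⟩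
  · intro h
    apply hq1
    ext
    exact (QuotientGroup.eq_one_iff a).2 (Subgroup.mem_center_iff.2 h)
  · ext; simp
  · intro x y
    ext
    simp only [Subgroup.coe_mul]
    have h1 := Subgroup.mem_center_iff.1 (hza y) x
    have : x * y * a * (x * y)⁻¹ * a⁻¹ = x * (y * a * y⁻¹ * a⁻¹) * a * x⁻¹ * a⁻¹ := by group
    rw [this, h1]
    have h2 := Subgroup.mem_center_iff.1 (hza y) (x * a * x⁻¹ * a⁻¹)
    rw [h2]; group
  · intro g; simp

theorem abelian_gen [IsAlgClosed K] : ∀ (n : ℕ) (G : Type) [Group G] [Finite G]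
    [NeZero (Nat.card G : K)], 1 ≤ n → Emb K n G → (∀ a b : G, a * b = b * a) → GenLE G n := by
  intro n
  induction n using Nat.strong_induction_on with
  | _ n ih =>
  intro G _ _ _ hn hE hab
  rcases irr_or_split hn hE with h | h
  · obtain ⟨V, i1, i2, i3, ρ, rfl, h2, h3⟩ := h
    have : IsMulCommutative G := ⟨⟨hab⟩⟩
    have h1 := Representation.IsIrreducible.finrank_eq_one_of_isMulCommutative ρ
    rw [h1] at hE ⊢
    have := emb_one_cyclic hE
    exact genLE_cyclic
  · obtain ⟨a, b, ha, hb, hab', Q₁, Q₂, i1, i2, f₁, f₂, s1, s2, e1, e2, hi⟩ := h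
    have hk := Split.ker_emb f₁ f₂ e2 hi
    have := Finite.of_surjective _ s1
    have n1 := neZero_card_of_surj (K := K) f₁ s1
    have n2 := neZero_card_of_inj (K := K) f₁.ker.subtype f₁.ker.subtype_injective
    have g1 : GenLE Q₁ a := ih a (by omega) Q₁ ha e1 (by
      intro x y
      obtain ⟨x, rfl⟩ := s1 x
      obtain ⟨y, rfl⟩ := s1 y
      rw [← map_mul, hab, map_mul])
    have g2 : GenLE f₁.ker b := ih b (by omega) _ hb hk (fun x y => Subtype.ext (hab _ _))
    refine GenLE.mono (GenLE.extend f₁ g2 (m := a) ?_) (by omega)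
    rw [MonoidHom.range_eq_top.2 s1]
    exact g1.toTop

theorem pgroup_gen [IsAlgClosed K] (l : ℕ) [Fact l.Prime] : ∀ (n : ℕ) (G : Type) [Group G]
    [Finite G] [NeZero (Nat.card G : K)], 1 ≤ n → Emb K n G → IsPGroup l G →
    GenLE G (2 * n - 1) := by
  intro n
  induction n using Nat.strong_induction_on with
  | _ n ih =>
  intro G _ _ _ hn hE hG
  by_cases hab : ∀ a b : G, a * b = b * a
  · exact (abelian_gen n G hn hE hab).mono (by omega)
  have main : ∀ (G : Type) [Group G] [Finite G] [NeZero (Nat.card G : K)], 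
      Split K n G → IsPGroup l G → GenLE G (2 * n - 2) := by
    intro G _ _ _ h hG
    obtain ⟨a, b, ha, hb, hab', Q₁, Q₂, i1, i2, f₁, f₂, s1, s2, e1, e2, hi⟩ := h
    have hk := Split.ker_emb f₁ f₂ e2 hi
    have := Finite.of_surjective _ s1
    have n1 := neZero_card_of_surj (K := K) f₁ s1
    have n2 := neZero_card_of_inj (K := K) f₁.ker.subtype f₁.ker.subtype_injective
    have g1 : GenLE Q₁ (2 * a - 1) := ih a (by omega) Q₁ ha e1 (hG.of_surjective f₁ s1)
    have g2 : GenLE f₁.ker (2 * b - 1) := ih b (by omega) _ hb hk (hG.to_subgroup _)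
    refine GenLE.mono (GenLE.extend f₁ g2 (m := 2 * a - 1) ?_) (by omega)
    rw [MonoidHom.range_eq_top.2 s1]
    exact g1.toTop
  rcases irr_or_split hn hE with h | h
  · obtain ⟨V, i1, i2, i3, ρ, rfl, h2, h3⟩ := h
    obtain ⟨a, ha, z, hz⟩ := exists_second_center hG hab
    have hcyc := center_cyclic ρ h2 hn
    have hnt : Nontrivial V := (Module.finrank_pos_iff (R := K)).1 (by omega)
    obtain ⟨μ, hμ⟩ := Module.End.exists_eigenvalue (ρ a)
    have n2 := neZero_card_of_inj (K := K) z.ker.subtype z.ker.subtype_injective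
    have hsp : Split K (Module.finrank K V) z.ker := by
      refine split_of_invariant (ρ.comp z.ker.subtype) (h2.comp z.ker.subtype_injective)
        (Module.End.eigenspace (ρ a) μ) ?_ hμ ?_
      · rintro ⟨g, hg⟩ v hv
        rw [Module.End.mem_eigenspace_iff] at hv ⊢
        change ρ a (ρ g v) = μ • ρ g v
        have h1 := hz g
        rw [MonoidHom.mem_ker.1 hg] at h1
        have h4 : a * g = g * a := by
          rw [mul_inv_eq_iff_eq_mul] at h1
          simpa using h1.symm
        rw [← Module.End.mul_apply, ← map_mul, h4, map_mul, Module.End.mul_apply, hv, map_smul]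
      · intro htop
        apply ha
        apply central_of_scalar ρ h2 a μ
        ext v
        have : v ∈ Module.End.eigenspace (ρ a) μ := htop ▸ Submodule.mem_top
        rw [Module.End.mem_eigenspace_iff] at this
        simpa using this
    have g1 := main z.ker hsp (hG.to_subgroup _)
    exact (GenLE.extend z g1 (m := 1) genLE_cyclic).mono (by omega)
  · exact (main G h hG).mono (by omega)

theorem pgroup_abelian [IsAlgClosed K] (l : ℕ) [hl : Fact l.Prime] : ∀ (n : ℕ) (G : Type) [Group G]
    [Finite G] [NeZero (Nat.card G : K)], 1 ≤ n → n < l → Emb K n G → IsPGroup l G →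
    ∀ a b : G, a * b = b * a := by
  intro n
  induction n using Nat.strong_induction_on with
  | _ n ih =>
  intro G _ _ _ hn hnl hE hG
  rcases irr_or_split hn hE with h | h
  · by_contra hab
    obtain ⟨V, i1, i2, i3, ρ, rfl, h2, h3⟩ := h
    obtain ⟨a, ha, z, hz⟩ := exists_second_center hG hab
    push Not at ha
    obtain ⟨g, hg⟩ := ha
    have hnt : Nontrivial V := (Module.finrank_pos_iff (R := K)).1 (by omega)
    obtain ⟨μ, hμ⟩ := Module.End.exists_eigenvalue (ρ a)
    obtain ⟨c, hc⟩ := schur_central ρ (z g) (Subgroup.mem_center_iff.1 (z g).2)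
    have hpow : ∀ i : ℕ, ρ ((z g : G) ^ i) = (c ^ i) • 1 := by
      intro i
      rw [map_pow, hc, smul_pow, one_pow]
    have hev : ∀ i : ℕ, Module.End.HasEigenvalue (ρ a) (c ^ i * μ) := by
      intro i
      induction i with
      | zero => simpa using hμ
      | succ i ihi =>
        obtain ⟨v, hv, hv0⟩ := ihi.exists_hasEigenvector
        rw [Module.End.mem_eigenspace_iff] at hv
        refine Module.End.hasEigenvalue_of_hasEigenvector (x := ρ g⁻¹ v) ⟨?_, ?_⟩
        · rw [Module.End.mem_eigenspace_iff]
          have e : a * g⁻¹ = g⁻¹ * (z g * a) := by rw [← hz g]; group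
          rw [← Module.End.mul_apply, ← map_mul, e, map_mul, map_mul, hc,
            Module.End.mul_apply, Module.End.mul_apply, hv]
          simp only [LinearMap.smul_apply, Module.End.one_apply, map_smul, smul_smul]
          congr 1; ring
        · intro h0
          apply hv0
          have := congrArg (ρ g) h0
          rw [← Module.End.mul_apply, ← map_mul] at this
          simpa using this
    have hμ0 : μ ≠ 0 := by
      rintro rfl
      obtain ⟨v, hv, hv0⟩ := hμ.exists_hasEigenvector
      rw [Module.End.mem_eigenspace_iff, zero_smul] at hv
      apply hv0
      have := congrArg (ρ a⁻¹) hv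
      rw [← Module.End.mul_apply, ← map_mul] at this
      simpa using this
    have hzg : (z g : G) ≠ 1 := by
      intro h
      apply hg
      have := hz g
      rw [h, one_mul, mul_inv_eq_iff_eq_mul] at this
      exact this
    have hc0 : c ≠ 1 := by
      rintro rfl
      apply hzg
      apply h2
      rw [hc]; simp
    have hord : l ≤ orderOf c := by
      obtain ⟨k, hk⟩ := hG (z g : G)
      have hck : c ^ l ^ k = 1 := by
        have h5 := hpow (l ^ k)
        rw [hk, map_one] at h5
        obtain ⟨v, hv⟩ := exists_ne (0 : V)
        have := LinearMap.congr_fun h5 v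
        simp at this
        have h6 : (1 : K) • v = c ^ l ^ k • v := by rw [one_smul]; exact this
        exact (smul_left_injective K hv h6).symm
      have hd := orderOf_dvd_of_pow_eq_one hck
      obtain ⟨j, hj, hj2⟩ := (Nat.dvd_prime_pow hl.out).1 hd
      rcases j with _ | j
      · simp at hj2; exact absurd hj2 hc0
      · rw [hj2]; exact Nat.le_of_dvd (by have := hl.out.pos; positivity) (dvd_pow_self _ (by omega))
    have hinj : Function.Injective (fun i : Fin l => c ^ (i : ℕ) * μ) := by
      intro i j hij
      have := mul_right_cancel₀ hμ0 hij
      have := pow_injOn_Iio_orderOf (x := c) (Set.mem_Iio.2 (lt_of_lt_of_le i.2 hord))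
        (Set.mem_Iio.2 (lt_of_lt_of_le j.2 hord)) this
      exact Fin.ext this
    choose v hv using fun i : Fin l => (hev i).exists_hasEigenvector
    have hli := Module.End.eigenvectors_linearIndependent' (ρ a) _ hinj v hv
    have := hli.fintype_card_le_finrank
    rw [Fintype.card_fin] at this
    omega
  · obtain ⟨a, b, ha, hb, hab', Q₁, Q₂, i1, i2, f₁, f₂, s1, s2, e1, e2, hi⟩ := h
    have := Finite.of_surjective _ s1
    have := Finite.of_surjective _ s2
    have n1 := neZero_card_of_surj (K := K) f₁ s1
    have n2 := neZero_card_of_surj (K := K) f₂ s2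
    have g1 := ih a (by omega) Q₁ ha (by omega) e1 (hG.of_surjective f₁ s1)
    have g2 := ih b (by omega) Q₂ hb (by omega) e2 (hG.of_surjective f₂ s2)
    intro x y
    have := hi (x * y * (y * x)⁻¹) (by simp [g1 (f₁ x)]) (by simp [g2 (f₂ x)])
    exact mul_inv_eq_one.1 this

end


theorem extend_hom {R S M : Type} [CommRing R] [IsDomain R] [Field S] [Algebra R S]
    [Algebra.IsAlgebraic R S] [FaithfulSMul R S] [Field M] [IsAlgClosed M]
    (τ : R →+* M) (hτ : Function.Injective τ) :
    ∃ σ : S →+* M, ∀ r, σ (algebraMap R S r) = τ r := by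
  let := τ.toAlgebra
  have : FaithfulSMul R M := (faithfulSMul_iff_algebraMap_injective R M).2 hτ
  have : Module.IsTorsionFree R M := inferInstance
  have : Module.IsTorsionFree R S := inferInstance
  let σ : S →ₐ[R] M := IsAlgClosed.lift
  exact ⟨σ.toRingHom, fun r => σ.commutes r⟩

theorem exists_cyclotomic_hom_aux (K : Type) [Field K] [IsAlgClosed K] [CharZero K]
    (N m : ℕ) (hN : 1 ≤ N) (hm : m.Coprime N) (E : Type) [Field E] [Algebra ℚ E] [NeZero N]
    [IsCyclotomicExtension {N} ℚ E] [Algebra.IsAlgebraic ℚ E] [CharZero E] :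
    ∃ σ : K →+* K, ∀ x, x ^ N = 1 → σ x = x ^ m := by
  let : Algebra E K := (IsAlgClosed.lift (R := ℚ) (M := K) (S := E)).toRingHom.toAlgebra
  have hζ := IsCyclotomicExtension.zeta_spec N ℚ E
  have hζm := hζ.pow_of_coprime m hm
  let e : E ≃ₐ[ℚ] E := IsCyclotomicExtension.fromZetaAut hζm
    (Polynomial.cyclotomic.irreducible_rat (by omega))
  have he : e (IsCyclotomicExtension.zeta N ℚ E) = (IsCyclotomicExtension.zeta N ℚ E) ^ m :=
    IsCyclotomicExtension.fromZetaAut_spec _ _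
  obtain ⟨ι, v, hv⟩ := exists_isTranscendenceBasis' E K
  have halg := hv.isAlgebraic
  let τ0 : MvPolynomial ι E →+* K :=
    ((MvPolynomial.aeval v : MvPolynomial ι E →ₐ[E] K) : MvPolynomial ι E →+* K).comp
      (MvPolynomial.map (e : E →+* E))
  have hτ0 : Function.Injective τ0 := by
    intro a b hab
    exact MvPolynomial.map_injective _ e.injective (hv.1 hab)
  obtain ⟨σ, hσ⟩ := extend_hom (R := Algebra.adjoin E (Set.range v)) (S := K) (M := K)
    (τ0.comp (hv.1.aevalEquiv.symm : _ →+* MvPolynomial ι E))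
    (hτ0.comp hv.1.aevalEquiv.symm.injective)
  have hE : ∀ x : E, σ (algebraMap E K x) = algebraMap E K (e x) := by
    intro x
    have := hσ (algebraMap E _ x)
    rw [← IsScalarTower.algebraMap_apply] at this
    rw [this]
    have h2 : hv.1.aevalEquiv.symm (algebraMap E _ x) = MvPolynomial.C x := by
      rw [AlgEquiv.commutes]; rfl
    change τ0 (hv.1.aevalEquiv.symm (algebraMap E _ x)) = _
    rw [h2]
    simp [τ0]
  refine ⟨σ, fun x hx => ?_⟩
  have hζK := hζ.map_of_injective (FaithfulSMul.algebraMap_injective E K)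
  obtain ⟨i, _, rfl⟩ := hζK.eq_pow_of_pow_eq_one hx
  rw [map_pow, hE, he, map_pow]
  ring

theorem exists_cyclotomic_hom (K : Type) [Field K] [IsAlgClosed K] [CharZero K]
    (N m : ℕ) (hN : 1 ≤ N) (hm : m.Coprime N) :
    ∃ σ : K →+* K, ∀ x, x ^ N = 1 → σ x = x ^ m := by
  have : NeZero N := ⟨by omega⟩
  have : IsCyclotomicExtension {N} ℚ (CyclotomicField N ℚ) :=
    CyclotomicField.isCyclotomicExtension N ℚ
  have := IsCyclotomicExtension.finiteDimensional {N} ℚ (CyclotomicField N ℚ)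
  exact exists_cyclotomic_hom_aux K N m hN hm (CyclotomicField N ℚ)


section
variable {K : Type} [Field K] [IsAlgClosed K] {V : Type} [AddCommGroup V] [Module K V]
  [FiniteDimensional K V]

theorem root_pow (A : Module.End K V) (M : ℕ) (hA : A ^ M = 1) (μ : K)
    (hμ : μ ∈ A.charpoly.roots) : μ ^ M = 1 := by
  have h1 : Module.End.HasEigenvalue A μ :=
    (Module.End.hasEigenvalue_iff_isRoot_charpoly A μ).2 (Polynomial.isRoot_of_mem_roots hμ)
  obtain ⟨v, hv⟩ := h1.exists_hasEigenvector
  have := hv.pow_apply M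
  rw [hA] at this
  have h6 : (1 : K) • v = μ ^ M • v := by rw [one_smul]; exact this
  exact (smul_left_injective K hv.2 h6).symm

theorem trace_roots (A : Module.End K V) : LinearMap.trace K V A = A.charpoly.roots.sum :=
  Module.End.trace_eq_sum_roots_charpoly_of_splits (IsAlgClosed.splits _)

theorem sigma_trace (A : Module.End K V) (M : ℕ) (hA : A ^ M = 1) (c : ℕ) (σ : K →+* K)
    (hσ : ∀ x, x ^ M = 1 → σ x = x ^ c) :
    σ (LinearMap.trace K V A) = (A.charpoly.roots.map (· ^ c)).sum := by
  rw [trace_roots, map_multiset_sum]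
  congr 1
  exact Multiset.map_congr rfl fun x hx => hσ x (root_pow A M hA x hx)

theorem eq_one_of_roots [CharZero K] (A : Module.End K V) (l : ℕ) (hl : 1 ≤ l) (hA : A ^ l = 1)
    (h : ∀ μ ∈ A.charpoly.roots, μ = 1) : A = 1 := by
  have hdvd : minpoly K A ∣ Polynomial.X ^ l - 1 := by
    apply minpoly.dvd
    simp [hA]
  have hsep : (Polynomial.X ^ l - 1 : Polynomial K).Separable := by
    have : ((l : ℕ) : K) ≠ 0 := by exact_mod_cast (by omega : l ≠ 0)
    exact Polynomial.separable_X_pow_sub_C (n := l) (1 : K) this one_ne_zero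
  have hs := hsep.of_dvd hdvd
  have hnd := Polynomial.nodup_roots hs
  have hmon := minpoly.monic (Algebra.IsIntegral.isIntegral (R := K) A)
  have hsplit := IsAlgClosed.splits (minpoly K A)
  have hle : (minpoly K A).roots ≤ {1} := by
    rw [Multiset.le_iff_subset hnd]
    intro μ hμ
    rw [Multiset.mem_singleton]
    apply h
    have hm : (minpoly K A).IsRoot μ := Polynomial.isRoot_of_mem_roots hμ
    rw [Polynomial.mem_roots (LinearMap.charpoly_monic A).ne_zero]
    exact (Module.End.hasEigenvalue_iff_isRoot_charpoly A μ).1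
      (Module.End.hasEigenvalue_iff_isRoot.2 hm)
  have hd : minpoly K A ∣ Polynomial.X - Polynomial.C 1 := by
    rw [hsplit.eq_prod_roots_of_monic hmon]
    have := Multiset.prod_dvd_prod_of_le
      (Multiset.map_le_map (f := fun a : K => Polynomial.X - Polynomial.C a) hle)
    simpa using this
  have := minpoly.dvd_iff.1 hd
  simp at this
  exact sub_eq_zero.1 this

theorem trace_not_fixed [CharZero K] (A : Module.End K V) (l : ℕ) (hl : l.Prime) (hA : A ^ l = 1)
    (hA1 : A ≠ 1) (hn : Module.finrank K V + 1 < l) :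
    ∃ c, 1 ≤ c ∧ c < l ∧ (A.charpoly.roots.map (· ^ c)).sum ≠ A.charpoly.roots.sum := by
  classical
  by_contra hcon
  push Not at hcon
  set s := A.charpoly.roots with hs
  have hroot : ∀ x ∈ s, x ^ l = 1 := fun x hx => root_pow A l hA x hx
  have hcard : s.card ≤ Module.finrank K V := by
    rw [← LinearMap.charpoly_natDegree A]
    exact Polynomial.card_roots' _
  have hpos : s.filter (· ≠ 1) ≠ 0 := by
    intro h0
    apply hA1
    apply eq_one_of_roots A l hl.one_le hA
    intro μ hμ
    by_contra hne
    have : μ ∈ s.filter (· ≠ 1) := by rw [Multiset.mem_filter]; exact ⟨hμ, hne⟩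
    rw [h0] at this
    simp at this
  have hsum : ((l : K) - 1) * s.sum = (s.map (fun x => ∑ c ∈ Finset.Ico 1 l, x ^ c)).sum := by
    rw [Multiset.sum_map_sum]
    rw [Finset.sum_congr rfl (fun c hc => hcon c (Finset.mem_Ico.1 hc).1 (Finset.mem_Ico.1 hc).2)]
    rw [Finset.sum_const, Nat.card_Ico, nsmul_eq_mul, Nat.cast_sub hl.one_le, Nat.cast_one]
  have hin : ∀ x ∈ s, ∑ c ∈ Finset.Ico 1 l, x ^ c = if x = 1 then (l : K) - 1 else -1 := by
    intro x hx
    have h1 : ∑ c ∈ Finset.range l, x ^ c = 1 + ∑ c ∈ Finset.Ico 1 l, x ^ c := by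
      rw [Finset.range_eq_Ico, Finset.sum_eq_sum_Ico_succ_bot hl.pos]
      simp
    split_ifs with hx1
    · subst hx1; simp [Nat.cast_sub hl.one_le]
    · have := mul_geom_sum x l
      rw [hroot x hx, sub_self, mul_eq_zero] at this
      rcases this with h | h
      · exact absurd (sub_eq_zero.1 h) hx1
      · rw [h] at h1
        linear_combination -h1
  have hin2 : (s.map (fun x => ∑ c ∈ Finset.Ico 1 l, x ^ c)).sum =
      ((l : K) - 1) * (s.filter (· = 1)).card - (s.filter (· ≠ 1)).card := by
    rw [Multiset.map_congr rfl hin]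
    have : ∀ t : Multiset K, (t.map (fun x => if x = 1 then (l : K) - 1 else -1)).sum =
      ((l : K) - 1) * (t.filter (· = 1)).card - (t.filter (· ≠ 1)).card := by
      intro t
      induction t using Multiset.induction_on with
      | empty => simp
      | cons a t ih =>
        rw [Multiset.map_cons, Multiset.sum_cons, ih]
        by_cases ha : a = 1
        · simp [ha]; ring
        · simp [ha]; ring
    exact this s
  set k := (s.filter (· ≠ 1)).card with hk
  have hk0 : 0 < k := Multiset.card_pos.2 hpos
  have hkn : k ≤ Module.finrank K V := (Multiset.card_le_card (Multiset.filter_le _ _)).trans hcard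
  have hint : IsIntegral ℤ (s.sum - (s.filter (· = 1)).card : K) := by
    apply IsIntegral.sub
    · apply IsIntegral.multiset_sum
      intro x hx
      exact IsIntegral.of_pow hl.pos (by rw [hroot x hx]; exact isIntegral_one)
    · exact isIntegral_natCast _
  have hl1 : ((l : ℚ) - 1) ≠ 0 := by
    have : (1 : ℚ) < l := by exact_mod_cast hl.one_lt
    linarith
  have hl1K : ((l : K) - 1) ≠ 0 := by
    have : (l : K) ≠ 1 := by exact_mod_cast hl.one_lt.ne'
    exact sub_ne_zero.2 this
  have hq : (s.sum - (s.filter (· = 1)).card : K) = algebraMap ℚ K (-(k : ℚ) / ((l : ℚ) - 1)) := by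
    rw [hin2] at hsum
    simp only [map_div₀, map_neg, map_natCast, map_sub, map_one]
    rw [eq_div_iff hl1K]
    linear_combination hsum
  rw [hq, isIntegral_algebraMap_iff (algebraMap ℚ K).injective] at hint
  obtain ⟨z, hz⟩ := IsIntegrallyClosed.algebraMap_eq_of_integral hint
  rw [eq_div_iff hl1] at hz
  have hz' : z * ((l : ℤ) - 1) = -(k : ℤ) := by
    have : ((z * ((l : ℤ) - 1) : ℤ) : ℚ) = ((-(k : ℤ) : ℤ) : ℚ) := by push_cast; exact hz
    exact_mod_cast this
  have hdvd : ((l : ℤ) - 1) ∣ (k : ℤ) := ⟨-z, by linarith⟩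
  have := Int.le_of_dvd (by exact_mod_cast hk0) hdvd
  omega

end

section
variable {K : Type} [Field K] {V : Type} [AddCommGroup V] [Module K V]
  [FiniteDimensional K V] {G : Type} [Group G]

/-- Galois twist -/
noncomputable def twist (ρ : Representation K G V) (σ : K →+* K) :
    Representation K G (Fin (Module.finrank K V) → K) :=
  (Matrix.toLinAlgEquiv' : _ ≃ₐ[K] _).toAlgHom.toRingHom.toMonoidHom.comp
    ((σ.mapMatrix).toMonoidHom.comp
      ((LinearMap.toMatrixAlgEquiv (Module.finBasis K V)).toAlgHom.toRingHom.toMonoidHom.comp ρ))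

theorem twist_char (ρ : Representation K G V) (σ : K →+* K) (g : G) :
    (twist ρ σ).character g = σ (ρ.character g) := by
  have : (twist ρ σ) g = Matrix.toLin' ((LinearMap.toMatrix (Module.finBasis K V)
    (Module.finBasis K V) (ρ g)).map σ) := rfl
  rw [Representation.character, Representation.character, this, Matrix.trace_toLin'_eq,
    LinearMap.trace_eq_matrix_trace K (Module.finBasis K V) (ρ g)]
  simp [Matrix.trace]

variable [IsAlgClosed K] [CharZero K] [Finite G]

theorem finrank_hom_twist (ρ : Representation K G V) [ρ.IsIrreducible] (σ : K →+* K)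
    (g : G) (hg : σ (ρ.character g) ≠ ρ.character g) :
    Module.finrank K (Representation.IntertwiningMap ρ (twist ρ σ)) = 0 := by
  have : Subsingleton (Representation.IntertwiningMap ρ (twist ρ σ)) := by
    refine subsingleton_of_forall_eq 0 fun f => ?_
    rcases Representation.IsIrreducible.injective_or_eq_zero f with h | h
    · exfalso
      have hb : Function.Bijective f :=
        ⟨h, (LinearMap.injective_iff_surjective_of_finrank_eq_finrank (f := f.toLinearMap)
          (by simp)).1 h⟩
      have := Representation.char_iso (f.ofBijective hb)
      apply hg
      rw [← twist_char, ← this]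
    · exact h
  exact Module.finrank_zero_of_subsingleton

theorem finrank_hom_twist' (ρ : Representation K G V) [ρ.IsIrreducible] (σ : K →+* K)
    (g : G) (hg : σ (ρ.character g) ≠ ρ.character g) :
    Module.finrank K (Representation.IntertwiningMap (twist ρ σ) ρ) = 0 := by
  have : Subsingleton (Representation.IntertwiningMap (twist ρ σ) ρ) := by
    refine subsingleton_of_forall_eq 0 fun f => ?_
    rcases Representation.IsIrreducible.surjective_or_eq_zero f with h | h
    · exfalso
      have hb : Function.Bijective f :=
        ⟨(LinearMap.injective_iff_surjective_of_finrank_eq_finrank (f := f.toLinearMap)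
          (by simp)).2 h, h⟩
      have := Representation.char_iso (f.ofBijective hb)
      apply hg
      rw [← twist_char, this]
    · exact h
  exact Module.finrank_zero_of_subsingleton

theorem exists_nonzero_product (ρ : Representation K G V) [ρ.IsIrreducible] (σ τ : K →+* K)
    (g₁ : G) (hg₁ : σ (ρ.character g₁) ≠ ρ.character g₁)
    (g₂ : G) (hg₂ : τ (ρ.character g₂) ≠ ρ.character g₂) :
    ∃ g : G, σ (ρ.character g) ≠ ρ.character g ∧ τ (ρ.character g⁻¹) ≠ ρ.character g⁻¹ := by
  have : Fintype G := Fintype.ofFinite G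
  have hne : (Nat.card G : K) ≠ 0 := by exact_mod_cast Nat.card_pos.ne'
  have : Invertible (Nat.card G : K) := invertibleOfNonzero hne
  by_contra hcon
  push Not at hcon
  have h0 : ∑ g : G, (ρ.character g - σ (ρ.character g)) *
      (ρ.character g⁻¹ - τ (ρ.character g⁻¹)) = 0 := by
    apply Finset.sum_eq_zero
    intro g _
    by_cases h : σ (ρ.character g) = ρ.character g
    · rw [h]; simp
    · rw [hcon g h]; simp
  have e1 := Representation.card_inv_mul_sum_char_mul_char_eq_finrank ρ ρ
  have e2 := Representation.card_inv_mul_sum_char_mul_char_eq_finrank ρ (twist ρ σ)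
  have e3 := Representation.card_inv_mul_sum_char_mul_char_eq_finrank (twist ρ τ) ρ
  have e4 := Representation.card_inv_mul_sum_char_mul_char_eq_finrank (twist ρ τ) (twist ρ σ)
  rw [finrank_hom_twist ρ σ g₁ hg₁] at e2
  rw [finrank_hom_twist' ρ τ g₂ hg₂] at e3
  rw [Representation.IsIrreducible.finrank_intertwiningMap_self] at e1
  simp only [twist_char] at e2 e3 e4
  have : (Nat.card G : K)⁻¹ * ∑ g : G, (ρ.character g - σ (ρ.character g)) *
      (ρ.character g⁻¹ - τ (ρ.character g⁻¹)) = 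
      1 + (Module.finrank K (Representation.IntertwiningMap (twist ρ τ) (twist ρ σ)) : K) := by
    rw [← e4]
    have : ∀ g : G, (ρ.character g - σ (ρ.character g)) * (ρ.character g⁻¹ - τ (ρ.character g⁻¹)) =
      ρ.character g * ρ.character g⁻¹ - σ (ρ.character g) * ρ.character g⁻¹ 
      - ρ.character g * τ (ρ.character g⁻¹) + σ (ρ.character g) * τ (ρ.character g⁻¹) := by
        intro g; ring
    simp_rw [this]
    rw [Finset.sum_add_distrib, Finset.sum_sub_distrib, Finset.sum_sub_distrib]
    rw [mul_add, mul_sub, mul_sub, e1, e2, e3]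
    simp
  rw [h0, mul_zero] at this
  have h5 : (1 + Module.finrank K (Representation.IntertwiningMap (twist ρ τ) (twist ρ σ)) : ℕ) = 0 := by
    have h6 : ((1 + Module.finrank K (Representation.IntertwiningMap (twist ρ τ) (twist ρ σ)) : ℕ) : K)
      = 0 := by push_cast; exact this.symm
    exact_mod_cast h6
  omega

/-- For ρ with noncentral-type `l`-element. -/
theorem exists_sigma (ρ : Representation K G V) (l N' : ℕ) (hl : l.Prime) (hN' : 1 ≤ N')
    (hlN : l.Coprime N') (hn : Module.finrank K V + 1 < l) (x : G) (k : ℕ) (hx : x ^ l ^ k = 1)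
    (hx1 : ρ x ≠ 1) :
    ∃ σ : K →+* K, (∀ y, y ^ N' = 1 → σ y = y) ∧ ∃ g, σ (ρ.character g) ≠ ρ.character g := by
  have hex : ∃ j, (ρ x) ^ l ^ j = 1 := ⟨k, by rw [← map_pow, hx, map_one]⟩
  classical
  set j := Nat.find hex with hj
  have hj1 : (ρ x) ^ l ^ j = 1 := Nat.find_spec hex
  have hj0 : j ≠ 0 := by
    intro h; rw [h] at hj1; simp at hj1; exact hx1 hj1
  obtain ⟨i, hi⟩ := Nat.exists_eq_succ_of_ne_zero hj0
  have hi1 : (ρ x) ^ l ^ i ≠ 1 := Nat.find_min hex (by omega)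
  set A := ρ (x ^ l ^ i) with hA
  have hAl : A ^ l = 1 := by
    rw [hA, map_pow, ← pow_mul, ← pow_succ]; rw [hi] at hj1; exact hj1
  have hA1 : A ≠ 1 := by rw [hA, map_pow]; exact hi1
  obtain ⟨c, hc1, hcl, hc⟩ := trace_not_fixed A l hl hAl hA1 hn
  obtain ⟨m, hm1, hm2⟩ := Nat.chineseRemainder hlN c 1
  have hcop : m.Coprime (l * N') := by
    apply Nat.Coprime.mul_right
    · have : c.Coprime l := (Nat.coprime_of_lt_prime (by omega) hcl hl).symm
      rw [Nat.Coprime, hm1.gcd_eq]; exact this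
    · rw [Nat.Coprime, hm2.gcd_eq]; simp
  obtain ⟨σ, hσ⟩ := exists_cyclotomic_hom K (l * N') m (by have := hl.pos; nlinarith) hcop
  have hpow : ∀ (y : K) (M a b : ℕ), y ^ M = 1 → a ≡ b [MOD M] → y ^ a = y ^ b := by
    intro y M a b hy hab
    rw [pow_eq_pow_mod a hy, pow_eq_pow_mod b hy, hab]
  refine ⟨σ, ?_, x ^ l ^ i, ?_⟩
  · intro y hy
    rw [hσ y (by rw [mul_comm, pow_mul, hy, one_pow]), hpow y N' m 1 hy hm2, pow_one]
  · rw [Representation.character, ← hA, sigma_trace A l hAl c σ, trace_roots]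
    · exact hc
    · intro y hy
      rw [hσ y (by rw [pow_mul, hy, one_pow])]
      exact hpow y l m c hy hm1

end


theorem exists_neg_inv (n L : ℕ) (hL : 1 ≤ L) (h : n.Coprime L) : ∃ e, L ∣ n * e + 1 := by
  have h1 := Nat.ModEq.pow_totient h
  have h2 : 0 < L.totient := Nat.totient_pos.2 hL
  refine ⟨(L - 1) * n ^ (L.totient - 1), ?_⟩
  have h3 : n * ((L - 1) * n ^ (L.totient - 1)) = (L - 1) * n ^ L.totient := by
    obtain ⟨t, ht⟩ := Nat.exists_eq_succ_of_ne_zero h2.ne'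
    rw [ht, pow_succ]; simp; ring
  rw [h3]
  have h4 : (L - 1) * n ^ L.totient + 1 ≡ (L - 1) * 1 + 1 [MOD L] :=
    Nat.ModEq.add_right 1 (Nat.ModEq.mul_left _ h1)
  rw [mul_one, Nat.sub_add_cancel hL] at h4
  exact (Nat.modEq_zero_iff_dvd).1 (h4.trans (by simp [Nat.ModEq]))

section
variable {K : Type} [Field K] {V : Type} [AddCommGroup V] [Module K V]
  [FiniteDimensional K V] {G : Type} [Group G]

/-- determinant twist -/
noncomputable def detTwist (ρ : Representation K G V) (e : ℕ) : Representation K G V where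
  toFun g := (LinearMap.det (ρ g)) ^ e • ρ g
  map_one' := by simp
  map_mul' x y := by
    rw [map_mul, map_mul, mul_pow, smul_mul_smul_comm]

theorem detTwist_apply (ρ : Representation K G V) (e : ℕ) (g : G) :
    detTwist ρ e g = (LinearMap.det (ρ g)) ^ e • ρ g := rfl

theorem det_ne (ρ : Representation K G V) (g : G) : LinearMap.det (ρ g) ≠ 0 := by
  intro h
  have : LinearMap.det (ρ (g * g⁻¹)) = 1 := by rw [mul_inv_cancel, map_one, map_one]
  rw [map_mul, map_mul, h, zero_mul] at this
  exact zero_ne_one this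

theorem detTwist_irr (ρ : Representation K G V) [h : ρ.IsIrreducible] (e : ℕ) :
    (detTwist ρ e).IsIrreducible := by
  have : Nontrivial (Subrepresentation (detTwist ρ e)) := by
    obtain ⟨a, b, hab⟩ := (inferInstance : Nontrivial (Subrepresentation ρ))
    have hVn : Nontrivial V := by
      by_contra hV
      rw [not_nontrivial_iff_subsingleton] at hV
      exact hab (Subrepresentation.toSubmodule_injective (Subsingleton.elim _ _))
    refine ⟨⊥, ⊤, fun h => ?_⟩
    have : (⊥ : Submodule K V) = ⊤ := congrArg Subrepresentation.toSubmodule h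
    exact bot_ne_top this
  refine ⟨fun W => ?_⟩
  let W' : Subrepresentation ρ := ⟨W.toSubmodule, fun g v hv => by
    have h1 := W.apply_mem_toSubmodule g hv
    rw [detTwist_apply, LinearMap.smul_apply] at h1
    exact (Submodule.smul_mem_iff _ (pow_ne_zero _ (det_ne ρ g))).1 h1⟩
  rcases h.eq_bot_or_eq_top W' with h1 | h1
  · left
    have := congrArg Subrepresentation.toSubmodule h1
    exact Subrepresentation.toSubmodule_injective this
  · right
    have := congrArg Subrepresentation.toSubmodule h1
    exact Subrepresentation.toSubmodule_injective this

theorem lemmaLR [IsAlgClosed K] [CharZero K] [Finite G] (ρ : Representation K G V)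
    [ρ.IsIrreducible] (hρ : Function.Injective ρ) (hn : 1 ≤ Module.finrank K V)
    (l r : ℕ) (hl : l.Prime) (hr : r.Prime) (hlr : l ≠ r) (hnl : Module.finrank K V + 1 < l)
    (hnr : Module.finrank K V + 1 < r)
    (hx : ∃ x : G, (∃ k, x ^ l ^ k = 1) ∧ x ∉ Subgroup.center G)
    (hy : ∃ y : G, (∃ k, y ^ r ^ k = 1) ∧ y ∉ Subgroup.center G) :
    ∃ x y : G, x * y = y * x ∧ (∃ k, x ^ l ^ k = 1) ∧ x ∉ Subgroup.center G ∧
      (∃ k, y ^ r ^ k = 1) ∧ y ∉ Subgroup.center G := by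
  have hNpos : Nat.card G ≠ 0 := Nat.card_pos.ne'
  obtain ⟨a, N₁, hN₁', hN₁⟩ := Nat.exists_eq_pow_mul_and_not_dvd hNpos l hl.ne_one
  obtain ⟨b, N₂, hN₂', hN₂⟩ := Nat.exists_eq_pow_mul_and_not_dvd hNpos r hr.ne_one
  have hcop : (Module.finrank K V).Coprime (l ^ a * r ^ b) := by
    apply Nat.Coprime.mul_right
    · apply Nat.Coprime.pow_right
      exact (Nat.coprime_of_lt_prime (by omega) (by omega) hl).symm
    · apply Nat.Coprime.pow_right
      exact (Nat.coprime_of_lt_prime (by omega) (by omega) hr).symm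
  obtain ⟨e, he⟩ := exists_neg_inv _ (l ^ a * r ^ b) (Nat.pos_of_ne_zero (by
    have := hl.ne_zero; have := hr.ne_zero; positivity)) hcop
  set ρ0 := detTwist ρ e with hρ0
  have hirr : ρ0.IsIrreducible := detTwist_irr ρ e
  have hcen : ∀ x : G, x ∈ Subgroup.center G → x ^ (l ^ a * r ^ b) = 1 → ρ0 x = 1 := by
    intro x hx hx1
    obtain ⟨c, hc⟩ := schur_central ρ x (Subgroup.mem_center_iff.1 hx)
    have hVn : Nontrivial V := (Module.finrank_pos_iff (R := K)).1 hn
    have hc1 : c ^ (l ^ a * r ^ b) = 1 := by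
      have h5 := congrArg ρ hx1
      rw [map_pow, hc, smul_pow, one_pow, map_one] at h5
      obtain ⟨v, hv⟩ := exists_ne (0 : V)
      have := LinearMap.congr_fun h5 v
      have h6 : c ^ (l ^ a * r ^ b) • v = (1 : K) • v := by rw [one_smul]; exact this
      exact smul_left_injective K hv h6
    rw [hρ0, detTwist_apply, hc, LinearMap.det_smul, smul_smul]
    have h7 : LinearMap.det (1 : V →ₗ[K] V) = 1 := map_one _
    rw [h7, mul_one, ← pow_mul, ← pow_succ]
    obtain ⟨t, ht⟩ := he
    rw [ht, pow_mul, hc1, one_pow, one_smul]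
  have hncen : ∀ x : G, x ∉ Subgroup.center G → ρ0 x ≠ 1 := by
    intro x hx h1
    apply hx
    rw [Subgroup.mem_center_iff]
    apply central_of_scalar ρ hρ x ((LinearMap.det (ρ x) ^ e)⁻¹)
    rw [← h1, hρ0, detTwist_apply, smul_smul, inv_mul_cancel₀ (pow_ne_zero _ (det_ne ρ x)),
      one_smul]
  obtain ⟨x, ⟨k, hk⟩, hx⟩ := hx
  obtain ⟨y, ⟨j, hj⟩, hy⟩ := hy
  have hN₁0 : 1 ≤ N₁ := Nat.pos_of_ne_zero (by rintro rfl; simp at hN₁')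
  have hN₂0 : 1 ≤ N₂ := Nat.pos_of_ne_zero (by rintro rfl; simp at hN₂')
  obtain ⟨σ, hσ, g₁, hg₁⟩ := exists_sigma ρ0 l N₁ hl hN₁0 ((Nat.Prime.coprime_iff_not_dvd hl).2 hN₁')
    hnl x k hk (hncen x hx)
  obtain ⟨τ, hτ, g₂, hg₂⟩ := exists_sigma ρ0 r N₂ hr hN₂0 ((Nat.Prime.coprime_iff_not_dvd hr).2 hN₂')
    hnr y j hj (hncen y hy)
  obtain ⟨g, hg1, hg2⟩ := exists_nonzero_product ρ0 σ τ g₁ hg₁ g₂ hg₂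
  have key : ∀ (σ : K →+* K) (N : ℕ) (hσ : ∀ y, y ^ N = 1 → σ y = y) (g : G),
      σ (ρ0.character g) ≠ ρ0.character g → ρ0 (g ^ N) ≠ 1 := by
    intro σ N hσ g hg h1
    apply hg
    rw [map_pow] at h1
    rw [Representation.character, sigma_trace (ρ0 g) N h1 1 σ (by simpa using hσ), trace_roots]
    simp
  have k1 := key σ N₁ hσ g hg1
  have k2 := key τ N₂ hτ g⁻¹ hg2
  have o1 : (g ^ N₁) ^ l ^ a = 1 := by
    rw [← pow_mul, mul_comm, ← hN₁]; exact pow_card_eq_one'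
  have o2 : (g⁻¹ ^ N₂) ^ r ^ b = 1 := by
    rw [← pow_mul, mul_comm, ← hN₂]; exact pow_card_eq_one'
  refine ⟨g ^ N₁, g⁻¹ ^ N₂, ?_, ⟨a, o1⟩, ?_, ⟨b, o2⟩, ?_⟩
  · exact ((Commute.refl g).inv_right.pow_pow N₁ N₂)
  · intro h
    exact k1 (hcen _ h (by rw [pow_mul, o1, one_pow]))
  · intro h
    exact k2 (hcen _ h (by rw [mul_comm, pow_mul, o2, one_pow]))
end


theorem conj_into {G : Type} [Group G] [Finite G] (A : Subgroup G) (l : ℕ) (hl : l.Prime)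
    (hA : ¬ l ∣ A.index) (x : G) (k : ℕ) (hx : x ^ l ^ k = 1) : ∃ g : G, g⁻¹ * x * g ∈ A := by
  have : Fact l.Prime := ⟨hl⟩
  have hP : IsPGroup l (Subgroup.zpowers x) := by
    rintro ⟨y, hy⟩
    obtain ⟨i, rfl⟩ := Subgroup.mem_zpowers_iff.1 hy
    refine ⟨k, ?_⟩
    ext
    simp only [SubmonoidClass.mk_pow, OneMemClass.coe_one]
    rw [← zpow_natCast, ← zpow_mul, mul_comm, zpow_mul, zpow_natCast, hx, one_zpow]
  obtain ⟨q, hq⟩ := hP.nonempty_fixed_point_of_prime_not_dvd_card (G ⧸ A) hA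
  obtain ⟨g, rfl⟩ := QuotientGroup.mk_surjective q
  refine ⟨g, ?_⟩
  have h1 := hq ⟨x, Subgroup.mem_zpowers x⟩
  have h2 : ((x * g : G) : G ⧸ A) = (g : G ⧸ A) := h1
  rw [eq_comm, QuotientGroup.eq] at h2
  rwa [mul_assoc]

theorem hall_up {G : Type} [Group G] (L : Subgroup G) (B : Subgroup L)
    (hB : ∀ a ∈ B, ∀ b ∈ B, a * b = b * a) :
    ∃ A : Subgroup G, A ≤ L ∧ (∀ a ∈ A, ∀ b ∈ A, a * b = b * a) ∧ A.index = B.index * L.index ∧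
      ∀ x, ∀ hx : x ∈ L, (⟨x, hx⟩ : L) ∈ B → x ∈ A := by
  refine ⟨B.map L.subtype, Subgroup.map_subtype_le B, ?_, ?_, ?_⟩
  · rintro _ ⟨a, ha, rfl⟩ _ ⟨b, hb, rfl⟩
    exact congrArg L.subtype (hB a ha b hb)
  · rw [Subgroup.index_map_subtype]
  · intro x hx hxB
    exact ⟨⟨x, hx⟩, hxB, rfl⟩

theorem le_centralizer_of {G : Type} [Group G] (A : Subgroup G)
    (hA : ∀ a ∈ A, ∀ b ∈ A, a * b = b * a) (x : G) (hx : x ∈ A) :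
    A ≤ Subgroup.centralizer {x} := by
  intro a ha
  rw [Subgroup.mem_centralizer_singleton_iff]
  exact (hA a ha x hx)

theorem centralizer_ne_top {G : Type} [Group G] (x : G) (hx : x ∉ Subgroup.center G) :
    Subgroup.centralizer {x} ≠ ⊤ := by
  intro h
  apply hx
  rw [Subgroup.mem_center_iff]
  intro g
  have : g ∈ Subgroup.centralizer {x} := h ▸ Subgroup.mem_top g
  rw [Subgroup.mem_centralizer_singleton_iff] at this
  exact this

theorem conj_not_center {G : Type} [Group G] (x g : G) (hx : x ∉ Subgroup.center G) :
    g⁻¹ * x * g ∉ Subgroup.center G := by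
  intro h
  apply hx
  have := (inferInstance : (Subgroup.center G).Normal).conj_mem _ h g
  have e : g * (g⁻¹ * x * g) * g⁻¹ = x := by group
  rwa [e] at this

theorem conj_pow_eq_one {G : Type} [Group G] (x g : G) (m : ℕ) (hx : x ^ m = 1) :
    (g⁻¹ * x * g) ^ m = 1 := by
  have := conj_pow (a := g⁻¹) (b := x) (i := m)
  rw [inv_inv] at this
  rw [this, hx]; simp

section
variable {K : Type} [Field K] [IsAlgClosed K] [CharZero K]

theorem neZero_card (G : Type) [Group G] [Finite G] : NeZero (Nat.card G : K) :=
  ⟨by exact_mod_cast Nat.card_pos.ne'⟩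

theorem centralizer_index {G : Type} [Group G] [Finite G] {n : ℕ} (hn : 1 ≤ n) (hE : Emb K n G)
    (r : ℕ) (hr : r.Prime) (hnr : n < r) (y : G) (k : ℕ) (hy : y ^ r ^ k = 1) :
    ¬ r ∣ (Subgroup.centralizer {y}).index := by
  have : Fact r.Prime := ⟨hr⟩
  let P : Sylow r G := default
  obtain ⟨g, hg⟩ := conj_into (P : Subgroup G) r hr P.not_dvd_index y k hy
  have hP : ∀ a ∈ (P : Subgroup G), ∀ b ∈ (P : Subgroup G), a * b = b * a := by
    intro a ha b hb
    have := neZero_card (K := K) (P : Subgroup G)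
    have := pgroup_abelian (K := K) r n (P : Subgroup G) hn hnr (hE.subgroup _) P.isPGroup'
      ⟨a, ha⟩ ⟨b, hb⟩
    exact congrArg Subtype.val this
  have hle := le_centralizer_of _ hP _ hg
  intro hd
  apply P.not_dvd_index
  refine dvd_trans ?_ (Subgroup.index_dvd_of_le hle)
  have hidx : (Subgroup.centralizer {g⁻¹ * y * g}).index = (Subgroup.centralizer {y}).index := by
    have e : Subgroup.centralizer {g⁻¹ * y * g} =
        (Subgroup.centralizer {y}).comap (MulAut.conj g).toMonoidHom := by
      ext a
      rw [Subgroup.mem_comap, Subgroup.mem_centralizer_singleton_iff,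
        Subgroup.mem_centralizer_singleton_iff]
      simp only [MulEquiv.toMonoidHom_eq_coe, MonoidHom.coe_coe, MulAut.conj_apply]
      constructor
      · intro h
        have := congrArg (fun t => g * t * g⁻¹) h
        simp only [mul_assoc, mul_inv_cancel_left] at this
        simp only [mul_assoc]
        simpa using this
      · intro h
        have := congrArg (fun t => g⁻¹ * t * g) h
        simp only [mul_assoc, inv_mul_cancel_left] at this
        simp only [mul_assoc]
        simpa using this
    rw [e, Subgroup.index_comap_of_surjective _ (MulAut.conj g).surjective]
  rw [hidx]; exact hd

def HallOK (m : ℕ) (G : Type) [Group G] : Prop :=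
  ∃ A : Subgroup G, (∀ a ∈ A, ∀ b ∈ A, a * b = b * a) ∧
    ∀ l : ℕ, l.Prime → m + 1 < l → ¬ l ∣ A.index

theorem hall_irr (m n : ℕ) (hn : 1 ≤ n) (hnm : n ≤ m) (G : Type) [Group G] [Finite G]
    (hirr : IrrEmb K n G) (hE : Emb K n G) (ih : ∀ L : Subgroup G, L ≠ ⊤ → HallOK m L) :
    HallOK m G := by
  classical
  let NC : ℕ → Prop := fun r => r.Prime ∧ m + 1 < r ∧
    ∃ x : G, (∃ k, x ^ r ^ k = 1) ∧ x ∉ Subgroup.center G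
  have main : ∀ T : Finset ℕ, (∀ t ∈ T, NC t) → ∃ A : Subgroup G,
      (∀ a ∈ A, ∀ b ∈ A, a * b = b * a) ∧ ∀ t ∈ T, ¬ t ∣ A.index := by
    intro T
    induction T using Finset.induction_on with
    | empty => 
      intro _
      refine ⟨⊥, ?_, by simp⟩
      intro a ha b hb
      rw [Subgroup.mem_bot] at ha hb
      rw [ha, hb]
    | insert r T hrT ihT =>
      intro hT
      obtain ⟨hr, hmr, y, ⟨k, hk⟩, hy⟩ := hT r (Finset.mem_insert_self _ _)
      obtain ⟨A, hA, hAT⟩ := ihT fun t ht => hT t (Finset.mem_insert_of_mem ht)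
      -- it is enough to find an abelian A'' with T-prime index containing a noncentral r-element
      have fin : ∀ (D : Subgroup G), D ≠ ⊤ → (¬ r ∣ D.index) → (∀ t ∈ T, ¬ t ∣ D.index) →
          ∃ A : Subgroup G, (∀ a ∈ A, ∀ b ∈ A, a * b = b * a) ∧ ∀ t ∈ insert r T, ¬ t ∣ A.index := by
        intro D hD hrD hTD
        obtain ⟨B, hB, hBl⟩ := ih D hD
        obtain ⟨A', _, hA', hi, _⟩ := hall_up D B hB
        refine ⟨A', hA', ?_⟩
        intro t ht hd
        obtain ⟨htp, htm, _⟩ := hT t ht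
        rw [hi, htp.dvd_mul] at hd
        rcases hd with hd | hd
        · exact hBl t htp htm hd
        · rcases Finset.mem_insert.1 ht with rfl | ht
          · exact hrD hd
          · exact hTD t ht hd
      rcases T.eq_empty_or_nonempty with rfl | ⟨l, hlT⟩
      · exact fin (Subgroup.centralizer {y}) (centralizer_ne_top y hy)
          (centralizer_index hn hE r hr (by omega) y k hk) (by simp)
      · obtain ⟨hl, hml, x, hxk, hx⟩ := hT l (Finset.mem_insert_of_mem hlT)
        have hlr : l ≠ r := by rintro rfl; exact hrT hlT
        obtain ⟨V, i1, i2, i3, ρ, hfr, hinj, hirr⟩ := hirr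
        obtain ⟨x, y, hxy, ⟨kx, hkx⟩, hx, ⟨ky, hky⟩, hy⟩ := lemmaLR ρ hinj (by omega) l r hl hr hlr
          (by omega) (by omega) ⟨x, hxk, hx⟩ ⟨y, ⟨k, hk⟩, hy⟩
        obtain ⟨g, hg⟩ := conj_into A l hl (hAT l hlT) x kx hkx
        obtain ⟨B, hB, hBl⟩ := ih (Subgroup.centralizer {g⁻¹ * x * g})
          (centralizer_ne_top _ (conj_not_center x g hx))
        obtain ⟨A2, hA2C, hA2, hA2i, hA2m⟩ := hall_up _ B hB
        have hle := le_centralizer_of A hA _ hg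
        have hA2T : ∀ t ∈ T, ¬ t ∣ A2.index := by
          intro t ht hd
          obtain ⟨htp, htm, _⟩ := hT t (Finset.mem_insert_of_mem ht)
          rw [hA2i, htp.dvd_mul] at hd
          rcases hd with hd | hd
          · exact hBl t htp htm hd
          · exact hAT t ht (hd.trans (Subgroup.index_dvd_of_le hle))
        have hyC : g⁻¹ * y * g ∈ Subgroup.centralizer {g⁻¹ * x * g} := by
          rw [Subgroup.mem_centralizer_singleton_iff]
          have e1 : g⁻¹ * y * g * (g⁻¹ * x * g) = g⁻¹ * (y * x) * g := by group
          have e2 : g⁻¹ * x * g * (g⁻¹ * y * g) = g⁻¹ * (x * y) * g := by group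
          rw [e1, e2, hxy]
        obtain ⟨⟨c, hc⟩, hcB⟩ := conj_into B r hr (hBl r hr hmr) ⟨_, hyC⟩ ky (by
          ext
          exact conj_pow_eq_one y g _ hky)
        have hyA2 : c⁻¹ * (g⁻¹ * y * g) * c ∈ A2 := hA2m _ _ hcB
        have hyn := conj_not_center _ c (conj_not_center y g hy)
        refine fin (Subgroup.centralizer {c⁻¹ * (g⁻¹ * y * g) * c}) (centralizer_ne_top _ hyn)
          (centralizer_index hn hE r hr (by omega) _ ky
            (conj_pow_eq_one _ _ _ (conj_pow_eq_one _ _ _ hky))) ?_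
        intro t ht hd
        exact hA2T t ht (hd.trans (Subgroup.index_dvd_of_le (le_centralizer_of A2 hA2 _ hyA2)))
  obtain ⟨A, hA, hAT⟩ := main ((Nat.card G).primeFactors.filter NC)
    (fun t ht => (Finset.mem_filter.1 ht).2)
  refine ⟨A ⊔ Subgroup.center G, ?_, ?_⟩
  · intro a ha b hb
    rw [← SetLike.mem_coe, Subgroup.mul_normal] at ha hb
    obtain ⟨a1, ha1, z1, hz1, rfl⟩ := Set.mem_mul.1 ha
    obtain ⟨b1, hb1, z2, hz2, rfl⟩ := Set.mem_mul.1 hb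
    have c1 := Subgroup.mem_center_iff.1 hz1
    have c2 := Subgroup.mem_center_iff.1 hz2
    have h1 := hA a1 ha1 b1 hb1
    calc a1 * z1 * (b1 * z2) = a1 * (z1 * b1) * z2 := by group
      _ = (a1 * b1) * (z1 * z2) := by rw [← c1 b1]; group
      _ = (b1 * a1) * (z1 * z2) := by rw [h1]
      _ = b1 * (a1 * z2) * z1 := by rw [c2 z1]; group
      _ = b1 * z2 * (a1 * z1) := by rw [c2 a1]; group
  · intro l hl hml hd
    have : Fact l.Prime := ⟨hl⟩
    by_cases hNC : NC l
    · by_cases hlG : l ∣ Nat.card G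
      · refine hAT l (Finset.mem_filter.2 ⟨Nat.mem_primeFactors.2 ⟨hl, hlG, Nat.card_pos.ne'⟩, hNC⟩) ?_
        exact hd.trans (Subgroup.index_dvd_of_le le_sup_left)
      · exact hlG (hd.trans (Subgroup.index_dvd_card _))
    · let P : Sylow l G := default
      apply P.not_dvd_index
      refine hd.trans (Subgroup.index_dvd_of_le (le_trans ?_ le_sup_right))
      intro x hx
      by_contra hxc
      apply hNC
      refine ⟨hl, hml, x, ?_, hxc⟩
      obtain ⟨k, hk⟩ := P.isPGroup' ⟨x, hx⟩
      exact ⟨k, congrArg Subtype.val hk⟩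

theorem hall_main (m : ℕ) : ∀ (n : ℕ), 1 ≤ n → n ≤ m → ∀ (c : ℕ) (G : Type) [Group G] [Finite G],
    Nat.card G = c → Emb K n G → HallOK m G := by
  intro n
  induction n using Nat.strong_induction_on with
  | _ n ihn =>
  intro hn hnm c
  induction c using Nat.strong_induction_on with
  | _ c ihc =>
  intro G _ _ hc hE
  have ih : ∀ L : Subgroup G, L ≠ ⊤ → HallOK m L := by
    intro L hL
    refine ihc (Nat.card L) ?_ L rfl (hE.subgroup L)
    rw [← hc]
    exact lt_of_le_of_ne (Subgroup.card_le_card_group L) fun h => hL (Subgroup.card_eq_iff_eq_top L |>.1 h)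
  have := neZero_card (K := K) G
  rcases irr_or_split hn hE with h | h
  · exact hall_irr m n hn hnm G h hE ih
  · obtain ⟨a, b, ha, hb, hab', Q₁, Q₂, i1, i2, f₁, f₂, s1, s2, e1, e2, hi⟩ := h
    have := Finite.of_surjective _ s1
    have := Finite.of_surjective _ s2
    have red : ∀ (L : Subgroup G), L ≠ ⊤ → (∀ l : ℕ, l.Prime → m + 1 < l → ¬ l ∣ L.index) → HallOK m G := by
      intro L hL hLi
      obtain ⟨B, hB, hBl⟩ := ih L hL
      obtain ⟨A, _, hA, hAi, _⟩ := hall_up L B hB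
      refine ⟨A, hA, fun l hl hml hd => ?_⟩
      rw [hAi, hl.dvd_mul] at hd
      rcases hd with hd | hd
      · exact hBl l hl hml hd
      · exact hLi l hl hml hd
    obtain ⟨A₁, hA₁, hl₁⟩ := ihn a (by omega) ha (by omega) _ Q₁ rfl e1
    obtain ⟨A₂, hA₂, hl₂⟩ := ihn b (by omega) hb (by omega) _ Q₂ rfl e2
    by_cases h1 : A₁.comap f₁ = ⊤
    swap
    · refine red _ h1 ?_
      rw [Subgroup.index_comap_of_surjective _ s1]
      exact hl₁
    by_cases h2 : A₂.comap f₂ = ⊤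
    swap
    · refine red _ h2 ?_
      rw [Subgroup.index_comap_of_surjective _ s2]
      exact hl₂
    refine ⟨⊤, ?_, ?_⟩
    · intro x _ y _
      have m1 : ∀ x, f₁ x ∈ A₁ := fun x => by
        have : x ∈ A₁.comap f₁ := h1 ▸ Subgroup.mem_top x
        exact this
      have m2 : ∀ x, f₂ x ∈ A₂ := fun x => by
        have : x ∈ A₂.comap f₂ := h2 ▸ Subgroup.mem_top x
        exact this
      have := hi (x * y * (y * x)⁻¹) (by simp [hA₁ _ (m1 x) _ (m1 y)])
        (by simp [hA₂ _ (m2 x) _ (m2 y)])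
      exact mul_inv_eq_one.1 this
    · intro l hl _ hd
      rw [Subgroup.index_top] at hd
      exact hl.one_lt.ne' (Nat.dvd_one.1 hd)

end


theorem prime_count_bound (n : ℕ) (hn : 1 ≤ n) :
    ((Finset.Icc 1 n).filter Nat.Prime).card ≤ (n - 1) / 2 + 1 := by
  rw [← Finset.card_range ((n - 1) / 2 + 1)]
  refine Finset.card_le_card_of_injOn (fun l => (l - 1) / 2) ?_ ?_
  · intro l hl
    simp only [Finset.coe_filter, Finset.mem_Icc, Set.mem_setOf_eq] at hl
    simp only [Finset.coe_range, Set.mem_Iio]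
    have : (l - 1) / 2 ≤ (n - 1) / 2 := Nat.div_le_div_right (by omega)
    omega
  · intro a ha b hb hab
    simp only [Finset.coe_filter, Finset.mem_Icc, Set.mem_setOf_eq] at ha hb
    simp only at hab
    have h1 := ha.2.eq_two_or_odd
    have h2 := hb.2.eq_two_or_odd
    have h3 := ha.2.two_le
    have h4 := hb.2.two_le
    omega

theorem thmB_charZero {K : Type} [Field K] [IsAlgClosed K] [CharZero K] (n : ℕ) (hn : 1 ≤ n)
    (G : Type) [Group G] [Finite G] (hE : Emb K n G) : GenLE G (n ^ 2 + 2 * n - 1) := by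
  classical
  by_cases hn1 : n = 1
  · subst hn1
    have := emb_one_cyclic hE
    exact genLE_cyclic.mono (by norm_num)
  obtain ⟨A, hA, hAi⟩ := hall_main n n hn le_rfl _ G rfl hE
  have nz : ∀ L : Subgroup G, NeZero (Nat.card L : K) := fun L => neZero_card L
  have hAg : GenLE A n := by
    have := nz A
    refine abelian_gen (K := K) n A hn (hE.subgroup A) ?_
    rintro ⟨a, ha⟩ ⟨b, hb⟩
    ext
    exact hA a ha b hb
  have hS : ∀ l : ℕ, ∃ P : Subgroup G, l.Prime → l ≤ n + 1 →
      (GenLE P (if l ≤ n then 2 * n - 1 else n) ∧ ¬ l ∣ P.index) := by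
    intro l
    by_cases hl : l.Prime
    · have : Fact l.Prime := ⟨hl⟩
      let P : Sylow l G := default
      refine ⟨P, fun _ hln => ⟨?_, P.not_dvd_index⟩⟩
      have := nz P
      split_ifs with h
      · exact pgroup_gen (K := K) l n P hn (hE.subgroup _) P.isPGroup'
      · exact abelian_gen (K := K) n P hn (hE.subgroup _)
          (pgroup_abelian (K := K) l n P hn (by omega) (hE.subgroup _) P.isPGroup')
    · exact ⟨⊥, fun h => absurd h hl⟩
  choose P hP using hS
  set T := (Finset.Icc 1 n).filter Nat.Prime with hT
  have g1 : GenLE (T.sup P : Subgroup G) (∑ i ∈ T, (2 * n - 1)) := by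
    refine GenLE.finset_sup T P _ ?_
    intro i hi
    simp only [hT, Finset.mem_filter, Finset.mem_Icc] at hi
    have := (hP i hi.2 (by omega)).1
    rwa [if_pos hi.1.2] at this
  rw [Finset.sum_const, smul_eq_mul] at g1
  have hc := prime_count_bound n hn
  have hle := Nat.mul_le_mul_right (2 * n - 1) hc
  obtain ⟨Q, hQg, hQ⟩ : ∃ Q : Subgroup G, GenLE Q (if Even n then n else 0) ∧
      ((n + 1).Prime → ¬ (n + 1) ∣ Q.index) := by
    by_cases h : (n + 1).Prime
    · have h2 : Even n := by
        rcases h.eq_two_or_odd with h | h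
        · omega
        · rw [Nat.even_iff]; omega
      refine ⟨P (n + 1), ?_, fun _ => (hP _ h le_rfl).2⟩
      have := (hP _ h le_rfl).1
      rw [if_neg (by omega)] at this
      rwa [if_pos h2]
    · exact ⟨⊥, genLE_of_subsingleton.mono (Nat.zero_le _), fun h' => absurd h' h⟩
  have htop : A ⊔ (T.sup P ⊔ Q) = ⊤ := by
    rw [← Subgroup.index_eq_one]
    by_contra hne
    obtain ⟨l, hl, hd⟩ := Nat.exists_prime_and_dvd hne
    by_cases h1 : n + 1 < l
    · exact hAi l hl h1 (hd.trans (Subgroup.index_dvd_of_le le_sup_left))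
    · by_cases h2 : l = n + 1
      · subst h2
        exact hQ hl (hd.trans (Subgroup.index_dvd_of_le (le_sup_right.trans le_sup_right)))
      · have hlT : l ∈ T := by
          simp only [hT, Finset.mem_filter, Finset.mem_Icc]
          exact ⟨⟨hl.one_lt.le, by omega⟩, hl⟩
        exact (hP l hl (by omega)).2 (hd.trans (Subgroup.index_dvd_of_le
          ((Finset.le_sup (f := P) hlT).trans (le_sup_left.trans le_sup_right))))
  refine (GenLE.extend' A _ htop hAg (g1.sup hQg)).mono ?_
  rcases Nat.even_or_odd n with h | h
  · rw [if_pos h]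
    obtain ⟨m, rfl⟩ := h
    have e : (m + m - 1) / 2 + 1 = m := by omega
    rw [e] at hle
    obtain ⟨k, rfl⟩ : ∃ k, m = k + 1 := ⟨m - 1, by omega⟩
    have e2 : 2 * (k + 1 + (k + 1)) - 1 = 4 * k + 3 := by omega
    have e3 : (k + 1 + (k + 1)) ^ 2 + 2 * (k + 1 + (k + 1)) - 1 = 4 * k ^ 2 + 12 * k + 7 := by
      have : (k + 1 + (k + 1)) ^ 2 + 2 * (k + 1 + (k + 1)) = 4 * k ^ 2 + 12 * k + 8 := by ring
      omega
    rw [e2] at hle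
    rw [e3, e2]
    nlinarith
  · rw [if_neg (by simpa using h)]
    obtain ⟨m, rfl⟩ := h
    have e : (2 * m + 1 - 1) / 2 + 1 = m + 1 := by omega
    rw [e] at hle
    have e2 : 2 * (2 * m + 1) - 1 = 4 * m + 1 := by omega
    have e3 : (2 * m + 1) ^ 2 + 2 * (2 * m + 1) - 1 = 4 * m ^ 2 + 8 * m + 2 := by
      have : (2 * m + 1) ^ 2 + 2 * (2 * m + 1) = 4 * m ^ 2 + 8 * m + 3 := by ring
      omega
    rw [e2] at hle
    rw [e3, e2]
    nlinarith


theorem lift_step {R M G : Type} [CommRing R] [Ring M] [Algebra R M] [Group G] [Fintype G]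
    (π e : R) (hπ : ∀ x : M, π • x = 0 → x = 0) (he : e * (Fintype.card G : R) = 1)
    (k : ℕ) (u : G → M) (hu : ∀ g h, ∃ c, u g * u h = u (g * h) + π ^ (k + 1) • c)
    (h1 : ∃ z, u 1 = 1 + π • z) :
    ∃ u' : G → M, (∀ g h, ∃ c, u' g * u' h = u' (g * h) + π ^ (k + 2) • c) ∧
      ∀ g, ∃ b, u' g = u g + π ^ (k + 1) • b := by
  classical
  choose c hc using hu
  obtain ⟨z, hz⟩ := h1
  have hπk : ∀ (j : ℕ) (x : M), π ^ j • x = 0 → x = 0 := by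
    intro j
    induction j with
    | zero => intro x hx; simpa using hx
    | succ j ih =>
      intro x hx
      rw [pow_succ, mul_smul] at hx
      exact hπ _ (ih _ hx)
  have hw : ∀ h, ∃ w, u h * u h⁻¹ = 1 + π • w := by
    intro h
    refine ⟨z + π ^ k • c h h⁻¹, ?_⟩
    rw [hc, mul_inv_cancel, hz, smul_add, ← mul_smul, ← pow_succ', add_assoc]
  choose w hw using hw
  have hx : ∀ g h, ∃ x, u h⁻¹ = u (g * h)⁻¹ * u g + π • x := by
    intro g h
    refine ⟨- π ^ k • c (g * h)⁻¹ g, ?_⟩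
    rw [hc]
    have : (g * h)⁻¹ * g = h⁻¹ := by group
    rw [this, neg_smul, smul_neg, ← mul_smul, ← pow_succ']
    abel
  choose x hx using hx
  have hcoc : ∀ g g' h, c (g * g') h + c g g' * u h = c g (g' * h) + u g * c g' h := by
    intro g g' h
    rw [← sub_eq_zero]
    apply hπk (k + 1)
    have h1 : (u g * u g') * u h = u g * (u g' * u h) := mul_assoc _ _ _
    rw [hc g g', hc g' h, add_mul, mul_add, hc (g * g') h, hc g (g' * h), mul_assoc g g' h,
      smul_mul_assoc, mul_smul_comm] at h1
    rw [smul_sub, smul_add, smul_add, sub_eq_zero]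
    have h2 := h1
    rw [add_assoc, add_assoc] at h2
    exact add_left_cancel h2
  let b : G → M := fun g => e • ∑ h, c g h * u h⁻¹
  have key : ∀ g g', ∃ y, c g g' + b (g * g') = b g * u g' + u g * b g' + π • y := by
    intro g g'
    refine ⟨e • ∑ h, (c g (g' * h) * x g' h - c g g' * w h), ?_⟩
    have hs : ∀ h, c (g * g') h * u h⁻¹ + c g g' =
        (c g (g' * h) * u (g' * h)⁻¹) * u g' + u g * (c g' h * u h⁻¹) +
          π • (c g (g' * h) * x g' h - c g g' * w h) := by
      intro h
      have h1 := congrArg (· * u h⁻¹) (hcoc g g' h)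
      simp only [add_mul] at h1
      rw [mul_assoc (c g g'), hw, mul_add, mul_one, mul_smul_comm] at h1
      have h2 : c g (g' * h) * u h⁻¹ = c g (g' * h) * u (g' * h)⁻¹ * u g' +
          π • (c g (g' * h) * x g' h) := by
        conv_lhs => rw [hx g' h]
        rw [mul_add, mul_smul_comm, mul_assoc]
      rw [h2] at h1
      rw [smul_sub]
      rw [mul_assoc (u g)] at h1
      rw [← sub_eq_zero] at h1 ⊢
      rw [← h1]
      abel
    have hsum := Finset.sum_congr rfl (fun h (_ : h ∈ Finset.univ) => hs h)
    rw [Finset.sum_add_distrib, Finset.sum_add_distrib, Finset.sum_add_distrib, ← Finset.sum_mul,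
      ← Finset.mul_sum, ← Finset.smul_sum, Finset.sum_const, Finset.card_univ] at hsum
    have hre : ∑ h, c g (g' * h) * u (g' * h)⁻¹ = ∑ h, c g h * u h⁻¹ :=
      Equiv.sum_comp (Equiv.mulLeft g') (fun h => c g h * u h⁻¹)
    rw [hre] at hsum
    have h3 := congrArg (e • ·) hsum
    simp only [smul_add] at h3
    have h4 : e • (Fintype.card G • c g g') = c g g' := by
      rw [← Nat.cast_smul_eq_nsmul R, ← mul_smul, he, one_smul]
    rw [h4, ← smul_mul_assoc, ← mul_smul_comm, smul_comm e π] at h3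
    rw [add_comm (c g g')]
    exact h3
  refine ⟨fun g => u g - π ^ (k + 1) • b g, ?_, fun g => ⟨- b g, by simp only [smul_neg, sub_eq_add_neg]⟩⟩
  intro g g'
  obtain ⟨y, hy⟩ := key g g'
  refine ⟨y + π ^ k • (b g * b g'), ?_⟩
  have hy' : c g g' = b g * u g' + u g * b g' + π • y - b (g * g') := by
    rw [← hy]; abel
  simp only [sub_mul, mul_sub, smul_mul_assoc, mul_smul_comm]
  rw [hc, hy']
  simp only [smul_add, smul_sub, ← mul_smul]
  have e1 : π ^ (k + 1) * π = π ^ (k + 2) := by ring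
  have e2 : π ^ (k + 1) * π ^ (k + 1) = π ^ (k + 2) * π ^ k := by ring
  rw [e1, e2]
  abel

theorem lift_rep {R k G : Type} [CommRing R] [CommRing k] [Group G] [Fintype G] (π e : R)
    (hπ : ∀ x : R, π * x = 0 → x = 0) (he : e * (Fintype.card G : R) = 1)
    [IsAdicComplete (Ideal.span {π}) R] (q : R →+* k) (hq : Function.Surjective q)
    (hker : ∀ x, q x = 0 ↔ ∃ y, x = π * y) (n : ℕ) (ρ : G →* Matrix (Fin n) (Fin n) k) :
    ∃ ρ' : G →* Matrix (Fin n) (Fin n) R, ∀ g, q.mapMatrix (ρ' g) = ρ g := by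
  classical
  have hπM : ∀ x : Matrix (Fin n) (Fin n) R, π • x = 0 → x = 0 := by
    intro x hx
    ext i j
    exact hπ _ (congrFun (congrFun hx i) j)
  have hkerM : ∀ x y : Matrix (Fin n) (Fin n) R, q.mapMatrix x = q.mapMatrix y → ∃ z : Matrix (Fin n) (Fin n) R, x = y + π • z := by
    intro x y hxy
    have : ∀ i j, ∃ t, x i j - y i j = π * t := by
      intro i j
      rw [← hker, map_sub, sub_eq_zero]
      exact congrFun (congrFun hxy i) j
    choose t ht using this
    refine ⟨Matrix.of t, ?_⟩
    ext i j
    have := ht i j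
    simp only [Matrix.add_apply, Matrix.smul_apply, Matrix.of_apply, smul_eq_mul]
    rw [← this]; ring
  have hqπ : q π = 0 := (hker π).2 ⟨1, by simp⟩
  have hmapπ : ∀ (j : ℕ) (x : Matrix (Fin n) (Fin n) R), q.mapMatrix (π ^ (j + 1) • x) = 0 := by
    intro j x
    ext a b
    simp [hqπ]
  choose s hs using hq
  let Good : ℕ → (G → Matrix (Fin n) (Fin n) R) → Prop := fun m u =>
    (∀ g h, ∃ c, u g * u h = u (g * h) + π ^ (m + 1) • c) ∧ ∀ g, q.mapMatrix (u g) = ρ g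
  let u0 : G → Matrix (Fin n) (Fin n) R := fun g => (ρ g).map s
  have hu0 : ∀ g, q.mapMatrix (u0 g) = ρ g := by
    intro g; ext i j; exact hs _
  have good0 : Good 0 u0 := by
    refine ⟨fun g h => ?_, hu0⟩
    rw [zero_add, pow_one]
    apply hkerM
    rw [map_mul, hu0, hu0, hu0, map_mul]
  have hstep : ∀ m (u : {u // Good m u}), ∃ u' : {u // Good (m + 1) u},
      ∀ g, ∃ b, u'.1 g = u.1 g + π ^ (m + 1) • b := by
    rintro m ⟨u, hu, hq⟩
    obtain ⟨u', h1, h2⟩ := lift_step (M := Matrix (Fin n) (Fin n) R) π e hπM he m u hu (hkerM _ _ (by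
      rw [hq, map_one, map_one]))
    refine ⟨⟨u', h1, fun g => ?_⟩, h2⟩
    obtain ⟨b, hb⟩ := h2 g
    rw [hb, map_add, hmapπ, add_zero, hq]
  choose next hnext using hstep
  let U : (m : ℕ) → {u // Good m u} := fun m => Nat.rec ⟨u0, good0⟩ (fun m u => next m u) m
  have hU : ∀ m g, ∃ b, (U (m + 1)).1 g = (U m).1 g + π ^ (m + 1) • b := fun m g =>
    hnext m (U m) g
  have hmk : ∀ m : ℕ, (Ideal.Quotient.mk (Ideal.span {π} ^ m)) (π ^ m) = 0 := by
    intro m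
    rw [Ideal.Quotient.eq_zero_iff_mem]
    exact Ideal.pow_mem_pow (Ideal.mem_span_singleton_self π) m
  have hmk2 : ∀ m t : ℕ, m ≤ t → (Ideal.Quotient.mk (Ideal.span {π} ^ m)) (π ^ t) = 0 := by
    intro m t h
    obtain ⟨d, rfl⟩ := Nat.exists_eq_add_of_le h
    rw [pow_add, map_mul, hmk, zero_mul]
  have hlim : ∀ g i j, ∃ L : R, ∀ m, (Ideal.Quotient.mk (Ideal.span {π} ^ m)) ((U m).1 g i j)
      = (Ideal.Quotient.mk (Ideal.span {π} ^ m)) L := by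
    intro g i j
    have hcauchy : ∀ {m t : ℕ}, m ≤ t → (U m).1 g i j ≡ (U t).1 g i j
        [SMOD (Ideal.span {π} ^ m • ⊤ : Submodule R R)] := by
      intro m t hmt
      induction t, hmt using Nat.le_induction with
      | base => rfl
      | succ t hmt ih =>
        refine ih.trans ?_
        obtain ⟨b, hb⟩ := hU t g
        rw [hb, SModEq.sub_mem, smul_eq_mul, Ideal.mul_top]
        simp only [Matrix.add_apply, Matrix.smul_apply, smul_eq_mul, sub_add_cancel_left]
        rw [← Ideal.Quotient.eq_zero_iff_mem, map_neg, map_mul, hmk2 m _ (by omega)]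
        simp
    obtain ⟨L, hL⟩ := IsPrecomplete.prec (inferInstance : IsPrecomplete (Ideal.span {π}) R) hcauchy
    refine ⟨L, fun m => ?_⟩
    have := hL m
    rw [SModEq.sub_mem, smul_eq_mul, Ideal.mul_top] at this
    exact Ideal.Quotient.eq.2 this
  choose L hL using hlim
  let LM : G → Matrix (Fin n) (Fin n) R := fun g => Matrix.of (L g)
  have hLM : ∀ m g, (Ideal.Quotient.mk (Ideal.span {π} ^ m)).mapMatrix (LM g) =
      (Ideal.Quotient.mk (Ideal.span {π} ^ m)).mapMatrix ((U m).1 g) := by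
    intro m g
    ext i j
    exact (hL g i j m).symm
  have hsep : ∀ x y : Matrix (Fin n) (Fin n) R, (∀ m, (Ideal.Quotient.mk (Ideal.span {π} ^ m)).mapMatrix x =
      (Ideal.Quotient.mk (Ideal.span {π} ^ m)).mapMatrix y) → x = y := by
    intro x y h
    ext i j
    rw [← sub_eq_zero]
    apply IsHausdorff.haus (inferInstance : IsHausdorff (Ideal.span {π}) R)
    intro m
    rw [SModEq.sub_mem, smul_eq_mul, Ideal.mul_top, sub_zero]
    exact Ideal.Quotient.eq.1 (congrFun (congrFun (h m) i) j)
  have hmul : ∀ g h, LM (g * h) = LM g * LM h := by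
    intro g h
    apply hsep
    intro m
    rw [map_mul, hLM, hLM, hLM, ← map_mul]
    obtain ⟨c, hc⟩ := (U m).2.1 g h
    rw [hc, map_add]
    have : (Ideal.Quotient.mk (Ideal.span {π} ^ m)).mapMatrix (π ^ (m + 1) • c) = 0 := by
      ext i j
      have := hmk2 m (m + 1) (by omega)
      simp only [RingHom.mapMatrix_apply, Matrix.map_apply, Matrix.smul_apply, smul_eq_mul,
        map_mul, this, zero_mul, Matrix.zero_apply]
    rw [this, add_zero]
  have hred : ∀ g, q.mapMatrix (LM g) = ρ g := by
    intro g
    rw [← (U 1).2.2 g]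
    ext i j
    have := hL g i j 1
    rw [pow_one, Ideal.Quotient.eq, Ideal.mem_span_singleton] at this
    obtain ⟨y, hy⟩ := this
    have h2 := congrArg q hy
    rw [map_sub, map_mul, hqπ, zero_mul, sub_eq_zero] at h2
    exact h2.symm
  have hone : LM 1 = 1 := by
    obtain ⟨z, hz⟩ := hkerM (LM 1) 1 (by rw [hred, map_one, map_one])
    have hid : LM 1 * LM 1 = LM 1 := by rw [← hmul, one_mul]
    have hD : ∀ m : ℕ, ∃ y, LM 1 = 1 + π ^ m • y := by
      intro m
      induction m with
      | zero => exact ⟨LM 1 - 1, by simp⟩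
      | succ m ih =>
        obtain ⟨y, hy⟩ := ih
        refine ⟨- (y * z), ?_⟩
        have h1 : (LM 1 - 1) * (LM 1 - 1) = - (LM 1 - 1) := by
          rw [sub_mul, mul_sub, hid]; simp
        have h2 : LM 1 - 1 = π ^ m • y := by rw [hy]; simp
        have h3 : LM 1 - 1 = π • z := by rw [hz]; simp
        have h4 : (LM 1 - 1) * (LM 1 - 1) = π ^ (m + 1) • (y * z) := by
          nth_rewrite 1 [h2]
          rw [h3, smul_mul_assoc, mul_smul_comm, ← mul_smul, pow_succ]
        rw [smul_neg, ← h4, h1]; simp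
    apply hsep
    intro m
    obtain ⟨y, hy⟩ := hD m
    rw [hy, map_add]
    have : (Ideal.Quotient.mk (Ideal.span {π} ^ m)).mapMatrix (π ^ m • y) = 0 := by
      ext i j
      simp only [RingHom.mapMatrix_apply, Matrix.map_apply, Matrix.smul_apply, smul_eq_mul,
        map_mul, hmk m, zero_mul, Matrix.zero_apply]
    rw [this, add_zero]
  exact ⟨⟨⟨LM, hone⟩, hmul⟩, hred⟩


theorem emb_lift (p : ℕ) [hp : Fact p.Prime] (k : Type) [Field k] [CharP k p] [PerfectRing k p]
    (G : Type) [Group G] [Finite G] (hG : ¬ p ∣ Nat.card G) (n : ℕ) (hE : Emb k n G) :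
    Emb (AlgebraicClosure (FractionRing (WittVector p k))) n G := by
  classical
  have := Fintype.ofFinite G
  obtain ⟨V, i1, i2, i3, ρ, hfr, hinj⟩ := hE
  let bV := Module.finBasisOfFinrankEq k V hfr
  let ρm : G →* Matrix (Fin n) (Fin n) k :=
    (LinearMap.toMatrixAlgEquiv bV : (V →ₗ[k] V) ≃ₐ[k] _).toMonoidHom.comp ρ
  have hρm : Function.Injective ρm := (LinearMap.toMatrixAlgEquiv bV).injective.comp hinj
  have hk : ((Nat.card G : ℕ) : k) ≠ 0 := by
    rwa [Ne, CharP.cast_eq_zero_iff k p]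
  have hu : IsUnit ((Nat.card G : ℕ) : WittVector p k) := by
    apply WittVector.isUnit_of_coeff_zero_ne_zero
    have : ((Nat.card G : WittVector p k)).coeff 0 = WittVector.constantCoeff (Nat.card G : WittVector p k) := rfl
    rw [this, map_natCast]
    exact hk
  obtain ⟨e, he⟩ := hu.exists_left_inv
  have : IsAdicComplete (Ideal.span {(p : WittVector p k)}) (WittVector p k) :=
    WittVector.isAdicCompleteIdealSpanP
  obtain ⟨ρ', hρ'⟩ := lift_rep (p : WittVector p k) e
    (fun x hx => (mul_eq_zero.1 hx).resolve_left (WittVector.p_nonzero p k))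
    (by rwa [← Nat.card_eq_fintype_card])
    (WittVector.constantCoeff (p := p) (R := k)) (WittVector.constantCoeff_surjective p) (by
      intro x
      rw [← RingHom.mem_ker, WittVector.ker_constantCoeff, Ideal.mem_span_singleton]
      rfl) n ρm
  let φ : WittVector p k →+* AlgebraicClosure (FractionRing (WittVector p k)) :=
    (algebraMap (FractionRing (WittVector p k)) _).comp (algebraMap (WittVector p k) _)
  have hφ : Function.Injective φ :=
    (algebraMap (FractionRing (WittVector p k)) _).injective.comp (IsFractionRing.injective _ _)
  refine ⟨Fin n → AlgebraicClosure (FractionRing (WittVector p k)), inferInstance, inferInstance,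
    inferInstance, (Matrix.toLinAlgEquiv' : _ ≃ₐ[AlgebraicClosure (FractionRing (WittVector p k))] _).toMonoidHom.comp
      ((φ.mapMatrix : _ →+* Matrix (Fin n) (Fin n) _).toMonoidHom.comp ρ'), by simp, ?_⟩
  have h1 : Function.Injective (φ.mapMatrix : Matrix (Fin n) (Fin n) _ →+* _) := by
    intro a b hab
    refine Matrix.ext fun i j => ?_
    exact hφ (congrFun (congrFun hab i) j)
  have h2 : Function.Injective ρ' := by
    intro a b hab
    apply hρm
    rw [← hρ', ← hρ', hab]
  exact (Matrix.toLinAlgEquiv').injective.comp (h1.comp h2)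

theorem witt_charZero (p : ℕ) [hp : Fact p.Prime] (k : Type) [Field k] [CharP k p] [PerfectRing k p] :
    CharZero (WittVector p k) := by
  refine charZero_of_inj_zero ?_
  intro n hn
  by_contra h0
  obtain ⟨a, m, hm, rfl⟩ := Nat.exists_eq_pow_mul_and_not_dvd h0 p hp.out.ne_one
  rw [Nat.cast_mul, Nat.cast_pow] at hn
  rcases mul_eq_zero.1 hn with h | h
  · exact WittVector.p_nonzero p k (eq_zero_of_pow_eq_zero h)
  · have := congrArg (WittVector.constantCoeff (p := p) (R := k)) h
    rw [map_natCast, map_zero, CharP.cast_eq_zero_iff k p] at this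
    exact hm this

theorem thmB (p : ℕ) [hp : Fact p.Prime] (k : Type) [Field k] [CharP k p] [PerfectRing k p]
    (G : Type) [Group G] [Finite G] (hG : ¬ p ∣ Nat.card G) (n : ℕ) (hn : 1 ≤ n) (hE : Emb k n G) :
    GenLE G (n ^ 2 + 2 * n - 1) := by
  have : CharZero (WittVector p k) := witt_charZero p k
  have : CharZero (FractionRing (WittVector p k)) := inferInstance
  have : CharZero (AlgebraicClosure (FractionRing (WittVector p k))) := inferInstance
  exact thmB_charZero n hn G (emb_lift p k G hG n hE)


theorem split_gen (p : ℕ) [hp : Fact p.Prime] (k : Type) [Field k] [CharP k p] [PerfectRing k p]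
    (C : Type) [Group C] [Finite C] (hC : ¬ p ∣ Nat.card C) (s : ℕ) (h : Split k s C) :
    GenLE C (s ^ 2) := by
  obtain ⟨a, b, ha, hb, rfl, Q₁, Q₂, _, _, f₁, f₂, h1, h2, e1, e2, hi⟩ := h
  have : Finite Q₁ := Finite.of_surjective f₁ h1
  have g1 : GenLE f₁.ker (b ^ 2 + 2 * b - 1) := by
    refine thmB p k f₁.ker (fun hd => hC (hd.trans (Subgroup.card_subgroup_dvd_card _))) b hb
      (Split.ker_emb f₁ f₂ e2 hi)
  have g2 : GenLE f₁.range (a ^ 2 + 2 * a - 1) := by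
    refine thmB p k f₁.range (fun hd => hC ?_) a ha (e1.subgroup _)
    exact hd.trans (Subgroup.card_dvd_of_surjective _ f₁.rangeRestrict_surjective)
  refine (GenLE.extend f₁ g1 g2).mono ?_
  obtain ⟨a, rfl⟩ : ∃ c, a = c + 1 := ⟨a - 1, by omega⟩
  obtain ⟨b, rfl⟩ : ∃ c, b = c + 1 := ⟨b - 1, by omega⟩
  have e1 : (b + 1) ^ 2 + 2 * (b + 1) - 1 = b ^ 2 + 4 * b + 2 := by
    have : (b + 1) ^ 2 + 2 * (b + 1) = b ^ 2 + 4 * b + 3 := by ring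
    omega
  have e2 : (a + 1) ^ 2 + 2 * (a + 1) - 1 = a ^ 2 + 4 * a + 2 := by
    have : (a + 1) ^ 2 + 2 * (a + 1) = a ^ 2 + 4 * a + 3 := by ring
    omega
  rw [e1, e2]
  nlinarith [Nat.zero_le (a * b)]

theorem complement_lemma (p : ℕ) [hp : Fact p.Prime] (k : Type) [Field k] [Finite k] [CharP k p]
    [PerfectRing k p] (G : Type) [Group G] [Finite G] (hG : p ∣ Nat.card G) (s : ℕ)
    (hE : Emb k s G) (hs : 1 ≤ s) (N : Subgroup G) [N.Normal] (hN : ∀ x : G, (∃ j, x ^ p ^ j = 1) → x ∈ N) :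
    ∃ C : Subgroup G, N ⊔ C = ⊤ ∧ GenLE C (s ^ 2) := by
  classical
  let P : Sylow p G := default
  have hPN : (P : Subgroup G) ≤ N := by
    intro x hx
    apply hN
    obtain ⟨j, hj⟩ := P.isPGroup' ⟨x, hx⟩
    exact ⟨j, congrArg Subtype.val hj⟩
  have hfr := Sylow.normalizer_sup_eq_top' P hPN
  set M := Subgroup.normalizer ((P : Subgroup G) : Set G) with hM
  have hPM : (P : Subgroup G) ≤ M := Subgroup.le_normalizer
  have hnorm : ((P : Subgroup G).subgroupOf M).Normal := Subgroup.normal_in_normalizer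
  have hidx : ¬ p ∣ ((P : Subgroup G).subgroupOf M).index := fun h =>
    P.not_dvd_index (h.trans (Subgroup.relIndex_dvd_index_of_le hPM))
  have hcard : ∃ j, Nat.card ((P : Subgroup G).subgroupOf M) = p ^ j := by
    rw [Nat.card_congr (Subgroup.subgroupOfEquivOfLe hPM).toEquiv]
    exact IsPGroup.iff_card.1 P.isPGroup'
  obtain ⟨j, hj⟩ := hcard
  obtain ⟨C, hC⟩ := Subgroup.exists_right_complement'_of_coprime
    (N := (P : Subgroup G).subgroupOf M) (by
      rw [hj]
      exact Nat.Coprime.pow_left _ ((Nat.Prime.coprime_iff_not_dvd hp.out).2 hidx))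
  have hCc : ¬ p ∣ Nat.card C := by
    rw [← hC.symm.index_eq_card]; exact hidx
  refine ⟨C.map M.subtype, ?_, ?_⟩
  · rw [eq_top_iff, ← hfr]
    refine sup_le ?_ le_sup_left
    have h1 := congrArg (Subgroup.map M.subtype) hC.sup_eq_top
    rw [Subgroup.map_sup, Subgroup.subgroupOf_map_subtype, ← MonoidHom.range_eq_map,
      Subgroup.range_subtype] at h1
    refine h1.symm.le.trans ?_
    exact sup_le_sup (inf_le_left.trans hPN) le_rfl
  · refine GenLE.congr (C.equivMapOfInjective _ M.subtype_injective) ?_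
    apply split_gen p k C hCc
    obtain ⟨V, i1, i2, i3, ρ, hfr, hinj⟩ := hE
    have hVf : Finite V := Module.finite_of_finite k
    rw [← hfr]
    have : NeZero (Nat.card C : k) := ⟨by rwa [Ne, CharP.cast_eq_zero_iff k p]⟩
    let W : Submodule k V := ⨅ x : (P : Subgroup G), LinearMap.ker (ρ x - 1)
    have hW : ∀ v, v ∈ W ↔ ∀ x ∈ (P : Subgroup G), ρ x v = v := by
      intro v
      simp [W, Submodule.mem_iInf, sub_eq_zero]
    refine split_of_invariant (ρ.comp (M.subtype.comp C.subtype))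
      (hinj.comp (M.subtype_injective.comp C.subtype_injective)) W ?_ ?_ ?_
    · rintro ⟨⟨c, hcM⟩, hcC⟩ v hv
      rw [hW] at hv ⊢
      intro x hx
      change ρ x (ρ c v) = ρ c v
      have h1 : c⁻¹ * x * c ∈ (P : Subgroup G) := by
        have := (Subgroup.mem_normalizer_iff.1 (M.inv_mem hcM) x).1 hx
        rwa [inv_inv] at this
      have h2 := hv _ h1
      have h3 : x * c = c * (c⁻¹ * x * c) := by group
      rw [← Module.End.mul_apply, ← map_mul, h3, map_mul, Module.End.mul_apply, h2]
    · let act : MulAction P V :=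
        { smul := fun x v => ρ x v
          one_smul := fun v => by change ρ 1 v = v; simp
          mul_smul := fun x y v => by
            change ρ (x * y) v = ρ x (ρ y v); rw [map_mul]; rfl }
      have hdvd : p ∣ Nat.card V := by
        rw [Module.natCard_eq_pow_finrank (K := k), hfr]
        refine dvd_pow ?_ (by omega)
        have := Fintype.ofFinite k
        obtain ⟨n, hp, hc⟩ := FiniteField.card k p
        rw [Nat.card_eq_fintype_card, hc]
        exact dvd_pow_self p n.2.ne'
      obtain ⟨b, hb, h0⟩ := P.isPGroup'.exists_fixed_point_of_prime_dvd_card_of_fixed_point V hdvd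
        (a := 0) (fun x => by change ρ x 0 = 0; simp)
      intro hbot
      apply h0
      have : b ∈ W := (hW b).2 fun x hx => hb ⟨x, hx⟩
      rw [hbot, Submodule.mem_bot] at this
      exact this.symm
    · intro htop
      have hPbot : (P : Subgroup G) = ⊥ := by
        rw [eq_bot_iff]
        intro x hx
        rw [Subgroup.mem_bot]
        apply hinj
        ext v
        rw [(hW v).1 (htop ▸ Submodule.mem_top) x hx]
        simp
      have := P.not_dvd_index
      rw [hPbot, Subgroup.index_bot] at this
      exact this hG

theorem main_gen (p : ℕ) [hp : Fact p.Prime] (k : Type) [Field k] [Finite k] [CharP k p]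
    [PerfectRing k p] (f : ℕ) (hf : 1 ≤ f) (hk : Nat.card k = p ^ f)
    (G : Type) [Group G] [Finite G] (s : ℕ) (hs : 2 ≤ s) (hE : Emb k s G) :
    GenLE G (2 * s ^ 2 * f - 1) := by
  have hsf : s ^ 2 ≤ s ^ 2 * f := Nat.le_mul_of_pos_right _ hf
  by_cases hG : p ∣ Nat.card G
  · let X : Set G := {x | ∃ j, x ^ p ^ j = 1}
    let N := Subgroup.normalClosure X
    obtain ⟨n, hn, hNg⟩ := chain_lemma p N ⟨Group.conjugatesOfSet X, by
      intro x hx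
      rw [Group.mem_conjugatesOfSet_iff] at hx
      obtain ⟨a, ⟨j, hj⟩, hc⟩ := hx
      obtain ⟨c, rfl⟩ := isConj_iff.1 hc
      exact ⟨j, by rw [conj_pow, hj]; simp⟩, rfl⟩
    obtain ⟨C, hC, hCg⟩ := complement_lemma p k G hG s hE (by omega) N
      (fun x hx => Subgroup.subset_normalClosure hx)
    have hlt : p ^ n < p ^ (s ^ 2 * f) := by
      obtain ⟨V, i1, i2, i3, ρ, hfr, hinj⟩ := hE
      have hVf : Finite V := Module.finite_of_finite k
      have : Finite (V →ₗ[k] V) := Module.finite_of_finite k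
      have : Nontrivial V := Module.nontrivial_of_finrank_pos (R := k) (by omega)
      have h1 : Nat.card (V →ₗ[k] V) = p ^ (s ^ 2 * f) := by
        rw [Module.natCard_eq_pow_finrank (K := k), Module.finrank_linearMap, hfr, hk, ← pow_mul]
        congr 1; ring
      rw [← h1]
      refine hn.trans_lt ((Nat.card_le_card_of_injective _ N.subtype_injective).trans_lt ?_)
      refine lt_of_le_of_ne (Nat.card_le_card_of_injective _ hinj) ?_
      intro heq
      have hb := (Nat.bijective_iff_injective_and_card ρ).2 ⟨hinj, heq⟩
      obtain ⟨g, hg⟩ := hb.2 0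
      have : ρ (g * g⁻¹) = 0 := by rw [map_mul, hg, zero_mul]
      rw [mul_inv_cancel, map_one] at this
      exact one_ne_zero this
    have hn2 := (Nat.pow_lt_pow_iff_right hp.out.one_lt).1 hlt
    refine (GenLE.extend' N C hC hNg hCg).mono ?_
    have : 2 * s ^ 2 * f = s ^ 2 * f + s ^ 2 * f := by ring
    omega
  · refine (thmB p k G hG s (by omega) hE).mono ?_
    have : 2 * s ^ 2 * f = s ^ 2 * f + s ^ 2 * f := by ring
    have : 2 * s ≤ s ^ 2 := by nlinarith
    omega

theorem stmt_15 (p : ℕ) [Fact p.Prime] (s f : ℕ) (hs : 1 ≤ s) (hf : 1 ≤ f)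
    (H : Subgroup (Matrix.GeneralLinearGroup (Fin s) (GaloisField p f))) :
    ∃ S : Finset (Matrix.GeneralLinearGroup (Fin s) (GaloisField p f)),
      S.card < 2 * s ^ 2 * f ∧
      Subgroup.closure (S : Set (Matrix.GeneralLinearGroup (Fin s) (GaloisField p f))) = H := by
  have hE : Emb (GaloisField p f) s (Matrix.GeneralLinearGroup (Fin s) (GaloisField p f)) := by
    refine ⟨Fin s → GaloisField p f, inferInstance, inferInstance, inferInstance,
      (Matrix.toLinAlgEquiv' : _ ≃ₐ[GaloisField p f] _).toMonoidHom.comp (Units.coeHom _), by simp, ?_⟩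
    exact (Matrix.toLinAlgEquiv').injective.comp Units.val_injective
  have hEH := hE.subgroup H
  have hpos : 0 < s ^ 2 * f := by positivity
  have hmain : GenLE H (2 * s ^ 2 * f - 1) := by
    by_cases h1 : s = 1
    · subst h1
      have := emb_one_cyclic hEH
      exact genLE_cyclic.mono (by omega)
    · exact main_gen p (GaloisField p f) f hf (GaloisField.card p f (by omega)) H s (by omega) hEH
  obtain ⟨S, h1, h2⟩ := (genLE_subgroup_iff H _).1 hmain
  refine ⟨S, ?_, h2⟩
  have : 2 * s ^ 2 * f = s ^ 2 * f + s ^ 2 * f := by ring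
  omega
end
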